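/- Let n be a nonnegative integer. There exists an extremal square-free word of length n over the three-letter alphabet Γ = {a, b, c} if and only if n belongs to the set A = {25, 41, 48, 50, 63, 71, 72, 77, 79, 81, 83, 84, 85} ∪ {m : m ≥ 87}. -/

import Mathlib

/-- A word `w` is square-free if it contains no factor `x ++ x` with `x` nonempty. -/
def SquareFree {α : Type*} (w : List α) : Prop :=
  ∀ x : List α, x ≠ [] → ¬ (x ++ x) <:+: w

/-- `v` is an extension of `w`: insert a single letter anywhere in `w`. -/
def IsExtension {α : Type*} (w v : List α) : Prop :=
  ∃ (w' w'' : List α) (a : α), w = w' ++ w'' ∧ v = w' ++ [a] ++ w''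

/-- `w` is extremal square-free. -/
def ExtremalSquareFree {α : Type*} (w : List α) : Prop :=
  SquareFree w ∧ ∀ v, IsExtension w v → ¬ SquareFree v

namespace TernaryWord

/-- The first `n` letters of `f` contain no square. -/
def NoSq (f : ℕ → ℕ) (n : ℕ) : Prop :=
  ∀ s q, 0 < q → s + 2 * q ≤ n → ∃ t < q, f (s + t) ≠ f (s + t + q)

/-- Insert the letter `a` at position `i`. -/
def ins (f : ℕ → ℕ) (i a : ℕ) : ℕ → ℕ :=
  fun t => if t < i then f t else if t = i then a else f (t - 1)

/-- Length of the longest suffix of `f 0 … f (k - 1)` on which `f t = f (t - q)`. -/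
def run (f : ℕ → ℕ) : ℕ → ℕ → ℕ
  | 0, _ => 0
  | k + 1, q => if q ≤ k ∧ f (k - q) = f k then run f k q + 1 else 0

theorem le_run_iff (f : ℕ → ℕ) (k q c : ℕ) :
    c ≤ run f k q ↔ c = 0 ∨ (q + c ≤ k ∧ ∀ t, k ≤ t + c → t < k → f (t - q) = f t) := by
  induction k generalizing c with
  | zero => simp only [run]; constructor <;> intro h <;> omega
  | succ k ih =>
    rcases c with _ | c
    · simp
    rw [run]
    by_cases h : q ≤ k ∧ f (k - q) = f k
    · rw [if_pos h, Nat.succ_le_succ_iff, ih]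
      constructor
      · rintro (rfl | ⟨h1, h2⟩)
        · refine Or.inr ⟨by omega, fun t ht ht' => ?_⟩
          obtain rfl : t = k := by omega
          exact h.2
        · refine Or.inr ⟨by omega, fun t ht ht' => ?_⟩
          rcases Nat.lt_succ_iff_lt_or_eq.1 ht' with h3 | rfl
          · exact h2 t (by omega) h3
          · exact h.2
      · rintro (h1 | ⟨h1, h2⟩)
        · exact absurd h1 (Nat.succ_ne_zero c)
        · exact Or.inr ⟨by omega, fun t ht ht' => h2 t (by omega) (by omega)⟩
    · rw [if_neg h]
      constructor
      · exact fun h' => absurd h' (Nat.not_succ_le_zero c)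
      · rintro (h1 | ⟨h1, h2⟩)
        · exact absurd h1 (Nat.succ_ne_zero c)
        · exact absurd ⟨by omega, h2 k (by omega) (by omega)⟩ h

theorem run_le {f : ℕ → ℕ} {k q : ℕ} : run f k q ≤ k := by
  have := (le_run_iff f k q (run f k q)).1 le_rfl
  omega

theorem run_congr {f g : ℕ → ℕ} {k : ℕ} (h : ∀ t < k, f t = g t) (q : ℕ) :
    run f k q = run g k q := by
  induction k with
  | zero => rfl
  | succ k ih =>
    rw [run, run, ih fun t ht => h t (by omega), h k (by omega), h (k - q) (by omega)]

theorem NoSq.mono {f : ℕ → ℕ} {m n : ℕ} (h : NoSq f n) (hmn : m ≤ n) : NoSq f m :=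
  fun s q hq hs => h s q hq (hs.trans hmn)

theorem NoSq.congr {f g : ℕ → ℕ} {n : ℕ} (h : NoSq f n) (hfg : ∀ t < n, f t = g t) :
    NoSq g n := by
  intro s q hq hs
  obtain ⟨t, ht, hne⟩ := h s q hq hs
  exact ⟨t, ht, by rwa [← hfg _ (by omega), ← hfg _ (by omega)]⟩

theorem NoSq.shift {f : ℕ → ℕ} {n : ℕ} (h : NoSq f n) (d m : ℕ) (hm : d + m ≤ n) :
    NoSq (fun t => f (d + t)) m := by
  intro s q hq hs
  obtain ⟨t, ht, hne⟩ := h (d + s) q hq (by omega)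
  exact ⟨t, ht, by simpa only [Nat.add_assoc] using hne⟩

theorem NoSq.run_lt {f : ℕ → ℕ} {k q : ℕ} (h : NoSq f k) (hq : 0 < q) : run f k q < q := by
  by_contra hc
  rcases (le_run_iff f k q q).1 (not_lt.1 hc) with h1 | ⟨h1, h2⟩
  · omega
  · obtain ⟨t, ht, hne⟩ := h (k - 2 * q) q hq (by omega)
    apply hne
    have := h2 (k - 2 * q + t + q) (by omega) (by omega)
    rwa [Nat.add_sub_cancel] at this

theorem NoSq.run_succ_le {f : ℕ → ℕ} {k q : ℕ} (h : NoSq f k) (hq : 0 < q) :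
    run f (k + 1) q ≤ q := by
  have := h.run_lt hq
  rw [run]
  split_ifs <;> omega

theorem NoSq.succ_iff {f : ℕ → ℕ} {k : ℕ} (h : NoSq f k) :
    NoSq f (k + 1) ↔ ∀ q, 0 < q → run f (k + 1) q < q := by
  refine ⟨fun h q hq => h.run_lt hq, fun hr s q hq hs => ?_⟩
  rcases Nat.lt_or_ge (s + 2 * q) (k + 1) with h1 | h1
  · exact h s q hq (by omega)
  by_contra! hc
  have : q ≤ run f (k + 1) q := by
    refine (le_run_iff _ _ _ _).2 (Or.inr ⟨by omega, fun t ht ht' => ?_⟩)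
    have := hc (t - q - s) (by omega)
    rw [show s + (t - q - s) = t - q by omega, show t - q + q = t by omega] at this
    exact this
  have := hr q hq
  omega

/-! ### Packed vectors of natural numbers -/

/-- The vector `g 0, …, g (Q - 1)` packed in fields of `B` bits. -/
def pack (B : ℕ) : ℕ → (ℕ → ℕ) → ℕ
  | 0, _ => 0
  | Q + 1, g => g 0 + 2 ^ B * pack B Q (fun j => g (j + 1))

theorem pack_add (B Q : ℕ) (g h : ℕ → ℕ) :
    pack B Q g + pack B Q h = pack B Q (fun j => g j + h j) := by
  induction Q generalizing g h with
  | zero => rfl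
  | succ Q ih => simp only [pack, ← ih]; ring

theorem pack_congr {B Q : ℕ} {g h : ℕ → ℕ} (H : ∀ j < Q, g j = h j) :
    pack B Q g = pack B Q h := by
  induction Q generalizing g h with
  | zero => rfl
  | succ Q ih => simp only [pack]; rw [H 0 (by omega), ih fun j hj => H (j + 1) (by omega)]

theorem add_mul_land {B a x X : ℕ} (ha : a < 2 ^ B) :
    (a + 2 ^ B * x) &&& X = (a &&& X % 2 ^ B) + 2 ^ B * (x &&& (X >>> B)) := by
  have h2 : (a &&& X % 2 ^ B) < 2 ^ B := Nat.and_lt_two_pow _ (Nat.mod_lt _ (by positivity))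
  apply Nat.eq_of_testBit_eq
  intro i
  rw [Nat.add_comm a, Nat.add_comm (a &&& _), Nat.testBit_and, Nat.testBit_two_pow_mul_add _ ha,
    Nat.testBit_two_pow_mul_add _ h2]
  split_ifs with hi
  · simp [Nat.testBit_and, Nat.testBit_mod_two_pow, hi]
  · simp only [Nat.testBit_and, Nat.testBit_shiftRight]
    rw [show B + (i - B) = i by omega]

theorem pack_land {B Q : ℕ} {g : ℕ → ℕ} {v : ℕ → Bool} {X : ℕ} (hg : ∀ j < Q, g j < 2 ^ B)
    (hX : ∀ j < Q, ∀ b < B, X.testBit (B * j + b) = v j) :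
    pack B Q g &&& X = pack B Q (fun j => if v j then g j else 0) := by
  induction Q generalizing g v X with
  | zero => simp [pack]
  | succ Q ih =>
    simp only [pack]
    rw [add_mul_land (hg 0 (by omega)), ih (v := fun j => v (j + 1)) (fun j hj => hg _ (by omega))]
    · congr 1
      apply Nat.eq_of_testBit_eq
      intro i
      rw [Nat.testBit_and, Nat.testBit_mod_two_pow]
      by_cases hi : i < B
      · have := hX 0 (by omega) i hi
        rw [Nat.mul_zero, Nat.zero_add] at this
        rw [this]
        cases v 0 <;> simp [hi]
      · have : (g 0).testBit i = false :=
          Nat.testBit_lt_two_pow ((hg 0 (by omega)).trans_le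
            (Nat.pow_le_pow_right (by omega) (by omega)))
        rw [this]
        cases v 0 <;> simp [this]
    · intro j hj b hb
      rw [Nat.testBit_shiftRight, ← hX (j + 1) (by omega) b hb]
      congr 1
      ring

theorem pack_land_pack {B Q : ℕ} {g h : ℕ → ℕ} (hg : ∀ j < Q, g j < 2 ^ B)
    (hh : ∀ j < Q, h j < 2 ^ B) :
    pack B Q g &&& pack B Q h = pack B Q (fun j => g j &&& h j) := by
  induction Q generalizing g h with
  | zero => simp [pack]
  | succ Q ih =>
    simp only [pack]
    rw [add_mul_land (hg 0 (by omega)), ← ih (fun j hj => hg _ (by omega))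
      (fun j hj => hh _ (by omega)), Nat.add_mul_mod_self_left, Nat.mod_eq_of_lt (hh 0 (by omega)),
      Nat.shiftRight_eq_div_pow, Nat.add_mul_div_left _ _ (by positivity),
      Nat.div_eq_of_lt (hh 0 (by omega)), Nat.zero_add]

theorem pack_eq_zero {B Q : ℕ} {g : ℕ → ℕ} : pack B Q g = 0 ↔ ∀ j < Q, g j = 0 := by
  induction Q generalizing g with
  | zero => simp [pack]
  | succ Q ih =>
    simp only [pack, Nat.add_eq_zero_iff, mul_eq_zero, ih]
    constructor
    · rintro ⟨h0, h1 | h1⟩ j hj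
      · exact absurd h1 (by positivity)
      · rcases j with _ | j
        · exact h0
        · exact h1 j (by omega)
    · exact fun h => ⟨h 0 (by omega), Or.inr fun j hj => h _ (by omega)⟩

/-! ### The bit-parallel square detector -/

/-- Parameters of a square detector for periods up to `Q` and words of length up to `J`:
fields have `B` bits, masks of distinct letters are `K` bits apart. -/
structure Params (B Q J K one C H : ℕ) : Prop where
  hK : K = B * J
  hQJ : Q ≤ J
  hB : 0 < B
  hQ : Q ≤ 2 ^ (B - 1)
  hone : one = pack B Q (fun _ => 1)
  hC : C = pack B Q (fun j => 2 ^ (B - 1) - (j + 1))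
  hH : H = pack B Q (fun _ => 2 ^ (B - 1))

/-- The number `r` packs the runs of `f 0 … f (k - 1)` and `m` its letter masks. -/
structure State (B Q J K : ℕ) (f : ℕ → ℕ) (k r m : ℕ) : Prop where
  runs : r = pack B Q (fun j => run f k (j + 1))
  masks : ∀ c < 3, ∀ j < J, ∀ b < B,
    m.testBit (K * c + (B * j + b)) = decide (j < k ∧ f (k - 1 - j) = c)

namespace State

variable {B Q J K one C H : ℕ} {f g : ℕ → ℕ} {k r m : ℕ}

theorem zero : State B Q J K f 0 0 0 where
  runs := (pack_eq_zero.2 fun _ _ => rfl).symm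
  masks := by simp

theorem congr (h : State B Q J K f k r m) (hfg : ∀ t < k, f t = g t) : State B Q J K g k r m where
  runs := h.runs.trans (pack_congr fun j _ => run_congr hfg (j + 1))
  masks c hc j hj b hb := by
    rw [h.masks c hc j hj b hb, decide_eq_decide]
    exact and_congr_right fun hjk => by rw [hfg _ (by omega)]

theorem push (P : Params B Q J K one C H) (h : State B Q J K f k r m) (hf : NoSq f k)
    (hk : k < J) {o : ℕ} (ho : o = K * f k) (hc : f k < 3) :
    State B Q J K f (k + 1) ((r + one) &&& (m >>> o))
      ((m <<< B) ||| ((2 ^ B - 1) <<< o)) where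
  runs := by
    have hlt : ∀ j < Q, run f k (j + 1) + 1 < 2 ^ B := fun j hj => by
      have h1 : run f k (j + 1) < j + 1 := hf.run_lt (Nat.succ_pos j)
      have h2 := P.hQ
      have h3 : 2 ^ B = 2 * 2 ^ (B - 1) := by
        rw [← pow_succ', Nat.sub_add_cancel P.hB]
      omega
    rw [h.runs, P.hone, pack_add, pack_land hlt (v := fun j => decide (j < k ∧ f (k - 1 - j) = f k))]
    · refine pack_congr fun j _ => ?_
      rw [run, Nat.sub_sub, Nat.add_comm 1 j]
      simp only [decide_eq_true_eq, Nat.succ_le_iff]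
    · intro j hj b hb
      rw [Nat.testBit_shiftRight, ho]
      exact h.masks _ hc j (hj.trans_le P.hQJ) b hb
  masks c' hc' j hj b hb := by
    have hB := P.hB
    have hBJ : B * j + b < K := by
      rw [P.hK]
      calc B * j + b < B * (j + 1) := by rw [Nat.mul_succ]; omega
        _ ≤ B * J := Nat.mul_le_mul_left _ hj
    have hright : ((2 ^ B - 1) <<< o).testBit (K * c' + (B * j + b)) =
        decide (c' = f k ∧ j = 0) := by
      rw [Nat.testBit_shiftLeft, Nat.testBit_two_pow_sub_one, ← Bool.decide_and,
        decide_eq_decide, ho]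
      constructor
      · rintro ⟨h1, h2⟩
        rcases lt_trichotomy c' (f k) with h3 | h3 | h3
        · have := Nat.mul_le_mul_left K (Nat.succ_le_of_lt h3)
          rw [Nat.mul_succ] at this
          omega
        · subst h3
          refine ⟨rfl, ?_⟩
          by_contra h4
          have := Nat.mul_le_mul_left B (Nat.pos_of_ne_zero h4)
          omega
        · have := Nat.mul_le_mul_left K (Nat.succ_le_of_lt h3)
          have h5 : B ≤ K := by
            rw [P.hK]; exact Nat.le_mul_of_pos_right _ (by omega)
          rw [Nat.mul_succ] at this
          omega
      · rintro ⟨rfl, rfl⟩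
        omega
    have hleft : (m <<< B).testBit (K * c' + (B * j + b)) =
        decide (0 < j ∧ j < k + 1 ∧ f (k - j) = c') := by
      rw [Nat.testBit_shiftLeft]
      rcases j with _ | j
      · rcases c' with _ | c'
        · simp; omega
        · have h1 := h.masks c' (by omega) (J - 1) (by omega) b hb
          have h2 : K * (c' + 1) + (B * 0 + b) - B = K * c' + (B * (J - 1) + b) := by
            have : B * J = B * (J - 1) + B := by
              rw [← Nat.mul_succ]; congr 1; omega
            rw [Nat.mul_succ]
            have := P.hK
            omega
          rw [h2, h1]
          simp
          omega
      · have h1 := h.masks c' hc' j (by omega) b hb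
        have h2 : K * c' + (B * (j + 1) + b) - B = K * c' + (B * j + b) := by
          rw [Nat.mul_succ]; omega
        have h3 : B ≤ K * c' + (B * (j + 1) + b) := by
          rw [Nat.mul_succ]; omega
        rw [h2, h1, decide_eq_true h3, Bool.true_and, decide_eq_decide, Nat.sub_sub,
          Nat.add_comm 1 j]
        omega
    rw [Nat.testBit_or, hright, hleft, ← Bool.decide_or, decide_eq_decide, Nat.add_sub_cancel]
    rcases j with _ | j
    · simp [eq_comm]
    · simp

theorem noSq_iff (P : Params B Q J K one C H) (h : State B Q J K f (k + 1) r m) (hf : NoSq f k)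
    (hk : k ≤ 2 * Q) : ((r + C) &&& H) = 0 ↔ NoSq f (k + 1) := by
  have hrun : ∀ j, run f (k + 1) (j + 1) ≤ j + 1 := fun j => hf.run_succ_le (Nat.succ_pos j)
  have hp : 2 ^ B = 2 * 2 ^ (B - 1) := by rw [← pow_succ', Nat.sub_add_cancel P.hB]
  have hQ := P.hQ
  rw [hf.succ_iff, h.runs, P.hC, P.hH, pack_add, pack_land_pack, pack_eq_zero]
  · constructor
    · intro H q hq
      rcases Nat.lt_or_ge Q q with h1 | h1
      · have := @run_le f (k + 1) q
        by_contra h2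
        rcases (le_run_iff f (k + 1) q q).1 (not_lt.1 h2) with h3 | h3 <;> omega
      · have h2 := H (q - 1) (by omega)
        rw [Nat.sub_add_cancel hq] at h2
        refine lt_of_le_of_ne (hf.run_succ_le hq) fun h3 => ?_
        rw [h3, Nat.add_sub_cancel' (h1.trans hQ), Nat.and_self] at h2
        exact absurd h2 (by positivity)
    · intro H j hj
      have h1 := H (j + 1) (Nat.succ_pos j)
      rw [Nat.and_two_pow, Nat.testBit_lt_two_pow (by omega)]
      simp
  · intro j hj
    have := hrun j
    omega
  · intro j hj
    have := Nat.two_pow_pos (B - 1)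
    omega

end State

local notation "select(" b "," t "," e ")" => @Bool.rec (fun _ => Bool) e t b

/-! ### Exhaustive search for short extremal words -/

/-- Pending insertions: `i` is the position, `s` marks how many letters have been read since,
`r` and `m` are the detector state of the word with the inserted letter and the bits of `l` mark
the periods which a later square may have. -/
inductive Gaps
  | nil
  | cons (i s r m l : ℕ) (t : Gaps)

section

variable (one comp high full dB dC : ℕ)

local notation "runsA(" r "," m "," o ")" => Nat.land (Nat.add r one) (Nat.shiftRight m o)
local notation "masksA(" m "," d ")" => Nat.lor (Nat.shiftLeft m 7) d
local notation "noSqA(" r ")" => Nat.beq (Nat.land (Nat.add r comp) high) 0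
local notation "liveA(" l "," m "," o "," k "," s ")" => Nat.land l (Nat.lor (Nat.shiftRight m o) (Nat.sub (Nat.pow 128 (Nat.sub 85 k)) s))

namespace Gaps

/-- Read a letter in all pending insertions, dropping those which get a square; the search is
pruned when some insertion can no longer produce a square. -/
noncomputable def step (o k d : ℕ) (g : Gaps) : (Gaps → Bool) → Bool :=
  @Gaps.rec (fun _ => (Gaps → Bool) → Bool) (fun κ => κ .nil)
    (fun i s r m l _ ih κ =>
      select(noSqA(runsA(r, m, o)),
        select(Nat.beq liveA(l, m, o, k, s) 0, true,
          ih fun t => κ (.cons i (Nat.shiftLeft s 7) runsA(r, m, o) masksA(m, d)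
            liveA(l, m, o, k, s) t)),
        ih κ)) g

/-- The first two pending insertions only allow periods which are incompatible. -/
noncomputable def clash (g : Gaps) : Bool :=
  @Gaps.rec (fun _ => Bool) false (fun _ _ _ _ l t _ =>
    @Gaps.rec (fun _ => Bool) false (fun i' _ _ _ l' _ _ =>
      Nat.beq (Nat.mod (Nat.lor l l')
        (Nat.pow 128 (Nat.sub (Nat.div (Nat.add 45 i') 2) 1))) 0) t) g

/-- Append a pending insertion. -/
noncomputable def snoc (g : Gaps) (i s r m l : ℕ) : Gaps :=
  @Gaps.rec (fun _ => Gaps) (.cons i s r m l .nil)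
    (fun i s r m l _ ih => .cons i s r m l ih) g

/-- There is no pending insertion. -/
noncomputable def isNil (g : Gaps) : Bool :=
  @Gaps.rec (fun _ => Bool) true (fun _ _ _ _ _ _ _ => false) g

end Gaps

/-- Lengths below `87` of extremal words, as a bit mask. -/
noncomputable def okLength (k : ℕ) : Bool :=
  Nat.beq 1 (Nat.mod (Nat.shiftRight 70880368949413550630109184 k) 2)

/-- Continue the search `next` after reading the letter with offset `o`, where `a` is the offset
of the letter to be inserted before it. -/
noncomputable def child (next : ℕ → ℕ → ℕ → ℕ → Gaps → Bool) (k r m : ℕ) (g : Gaps)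
    (o a d e : ℕ) : Bool :=
  Gaps.step one comp high o k d
    (@Bool.rec (fun _ => Gaps) g (g.snoc k 128 runsA(r, m, a) masksA(m, e) full)
      noSqA(runsA(r, m, a)))
    fun gaps => select(gaps.clash, true, next (Nat.succ k) o runsA(r, m, o) masksA(m, d) gaps)

/-- Branch over the two letters with offsets `x` and `y`. -/
noncomputable def branch (next : ℕ → ℕ → ℕ → ℕ → Gaps → Bool) (k r m : ℕ) (g : Gaps)
    (x y dx dy : ℕ) : Bool :=
  select(noSqA(runsA(r, m, x)),
    select(child one comp high full next k r m g x y dx dy,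
      select(noSqA(runsA(r, m, y)), child one comp high full next k r m g y x dy dx, true), false),
    select(noSqA(runsA(r, m, y)), child one comp high full next k r m g y x dy dx,
      select(g.isNil, okLength k, true)))

/-- Follow the letter with offset `x` or `y` according to the last bit of `b`. -/
noncomputable def follow (next : ℕ → ℕ → ℕ → ℕ → Gaps → Bool) (b k r m : ℕ) (g : Gaps)
    (x y dx dy : ℕ) : Bool :=
  select(Nat.beq (Nat.mod b 2) 0,
    select(noSqA(runsA(r, m, x)), child one comp high full next k r m g x y dx dy, true),
    select(noSqA(runsA(r, m, y)), child one comp high full next k r m g y x dy dx, true))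

local notation "others(" F "," p ")" => select(Nat.beq p 0, F 672 1344 dB dC, select(Nat.beq p 672, F 0 1344 127 dC, F 0 672 127 dB))

/-- Depth-first search over all square-free words extending a given one by fewer than `n` letters.
The word has length `k`, its last letter has offset `p`. -/
noncomputable def search (n : ℕ) : ℕ → ℕ → ℕ → ℕ → Gaps → Bool :=
  Nat.rec (motive := fun _ => ℕ → ℕ → ℕ → ℕ → Gaps → Bool) (fun _ _ _ _ _ => true)
    (fun _ ih k p r m g => others((branch one comp high full ih k r m g), p)) n

/-- Follow the path given by the `n` lowest bits of `b`, then search. -/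
noncomputable def searchPath (fuel n : ℕ) : ℕ → ℕ → ℕ → ℕ → ℕ → Gaps → Bool :=
  Nat.rec (motive := fun _ => ℕ → ℕ → ℕ → ℕ → ℕ → Gaps → Bool) (fun _ => search one comp high full dB dC fuel)
    (fun _ ih b k p r m g => others((follow one comp high full (ih (Nat.div b 2)) b k r m g), p)) n

/-! ### Soundness of the search -/

variable {one comp high full dB dC}

/-- The word `f 0 … f (n - 1)` is extremal. -/
structure Extremal (f : ℕ → ℕ) (n : ℕ) : Prop where
  lt_three : ∀ i, f i < 3
  noSq : NoSq f n
  ext : ∀ i ≤ n, ∀ a < 3, ¬ NoSq (ins f i a) (n + 1)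

theorem ins_of_lt {f : ℕ → ℕ} {i a t : ℕ} (h : t < i) : ins f i a t = f t := if_pos h

theorem ins_self {f : ℕ → ℕ} {i a : ℕ} : ins f i a i = a := by simp [ins]

theorem ins_succ {f : ℕ → ℕ} {i a t : ℕ} (h : i ≤ t) : ins f i a (t + 1) = f t := by
  simp [ins, show ¬ t + 1 < i by omega, show t + 1 ≠ i by omega]

/-- The entry of the search for the insertion of the letter `a` at position `i` is correct after
reading `k` letters. -/
structure GapOK (f : ℕ → ℕ) (n k i a s r m l : ℕ) : Prop where
  state : State 7 43 96 672 (ins f i a) (k + 1) r m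
  noSq : NoSq (ins f i a) (k + 1)
  le : i ≤ k
  lt_three : a < 3
  mark : s = 2 ^ (7 * (k + 1 - i))
  ne : 0 < i → a ≠ f (i - 1)
  live : ∀ p q, 0 < q → (∀ t < q, ins f i a (p + t) = ins f i a (p + t + q)) →
    p + 2 * q ≤ n + 1 → l.testBit (7 * (q - 1))

/-- All entries are correct, with positions below `c` and in lexicographic order. -/
def Valid (f : ℕ → ℕ) (n k c : ℕ) : ℕ → Gaps → Prop
  | _, .nil => True
  | b, .cons i s r m l t => ∃ a, b ≤ 3 * i + a ∧ i < c ∧ GapOK f n k i a s r m l ∧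
      Valid f n k c (3 * i + a + 1) t

theorem valid_cons {f : ℕ → ℕ} {n k c b i s r m l : ℕ} {t : Gaps} :
    Valid f n k c b (.cons i s r m l t) ↔ ∃ a, b ≤ 3 * i + a ∧ i < c ∧
      GapOK f n k i a s r m l ∧ Valid f n k c (3 * i + a + 1) t := Iff.rfl

theorem Valid.mono {f : ℕ → ℕ} {n k c c' b b' : ℕ} {g : Gaps} (h : Valid f n k c b g)
    (hc : c ≤ c') (hb : b' ≤ b) : Valid f n k c' b' g := by
  induction g generalizing b b' with
  | nil => trivial
  | cons i s r m l t ih =>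
    obtain ⟨a, h1, h2, h3, h4⟩ := h
    exact ⟨a, hb.trans h1, h2.trans_le hc, h3, ih h4 le_rfl⟩

theorem noSqA_iff (P : Params 7 43 96 672 one comp high) {f : ℕ → ℕ} {k r m o : ℕ} (h : State 7 43 96 672 f k r m) (hf : NoSq f k)
    (hk : k ≤ 86) (ho : o = 672 * f k) (hc : f k < 3) :
    noSqA(runsA(r, m, o)) = true ↔ NoSq f (k + 1) := by
  rw [← (h.push P hf (by omega) ho hc).noSq_iff P hf hk]
  exact ⟨fun h => Nat.eq_of_beq_eq_true h, fun h => congrArg (fun x => Nat.beq x 0) h⟩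

theorem stateA_push (P : Params 7 43 96 672 one comp high) {f : ℕ → ℕ} {k r m o d : ℕ} (h : State 7 43 96 672 f k r m) (hf : NoSq f k)
    (hk : k < 96) (ho : o = 672 * f k) (hd : d = 127 <<< o) (hc : f k < 3) :
    State 7 43 96 672 f (k + 1) runsA(r, m, o) masksA(m, d) := by
  subst hd
  exact h.push P hf hk ho hc

theorem testBit_two_pow_sub_two_pow {x y i : ℕ} (h1 : y ≤ i) (h2 : i < x) :
    (2 ^ x - 2 ^ y).testBit i = true := by
  have : 2 ^ x - 2 ^ y = (2 ^ (x - y) - 1) <<< y := by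
    rw [Nat.shiftLeft_eq, Nat.sub_mul, ← pow_add, Nat.sub_add_cancel (by omega), Nat.one_mul]
  rw [this, Nat.testBit_shiftLeft, Nat.testBit_two_pow_sub_one]
  simp
  omega

theorem Extremal.exists_square {f : ℕ → ℕ} {n i a : ℕ} (E : Extremal f n) (hi : i ≤ n)
    (ha : a < 3) : ∃ p q, 0 < q ∧ (∀ t < q, ins f i a (p + t) = ins f i a (p + t + q)) ∧
      p + 2 * q ≤ n + 1 := by
  have := E.ext i hi a ha
  unfold NoSq at this
  push Not at this
  obtain ⟨p, q, h1, h2, h3⟩ := this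
  exact ⟨p, q, h1, h3, h2⟩

/-- A square in a word with an inserted letter contains that letter. -/
theorem mem_square {f : ℕ → ℕ} {n i a p q : ℕ} (hf : NoSq f n) (hq : 0 < q)
    (h : ∀ t < q, ins f i a (p + t) = ins f i a (p + t + q)) (hp : p + 2 * q ≤ n + 1)
    (hi : i ≤ n) : p ≤ i ∧ i < p + 2 * q := by
  constructor
  · by_contra hc
    obtain ⟨t, ht, hne⟩ := hf (p - 1) q hq (by omega)
    apply hne
    have := h t ht
    rwa [show p + t = p - 1 + t + 1 by omega, show p - 1 + t + 1 + q = p - 1 + t + q + 1 by omega,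
      ins_succ (by omega), ins_succ (by omega)] at this
  · by_contra hc
    obtain ⟨t, ht, hne⟩ := hf p q hq (by omega)
    apply hne
    have := h t ht
    rwa [ins_of_lt (by omega), ins_of_lt (by omega)] at this

theorem GapOK.step (P : Params 7 43 96 672 one comp high) {f : ℕ → ℕ} {n k i a s r m l o d : ℕ} (h : GapOK f n k i a s r m l)
    (E : Extremal f n) (hn : n ≤ 86) (hk : k < n) (ho : o = 672 * f k) (hd : d = 127 <<< o)
    (hsq : NoSq (ins f i a) (k + 2)) :
    GapOK f n (k + 1) i a (Nat.shiftLeft s 7) runsA(r, m, o) masksA(m, d) liveA(l, m, o, k, s) where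
  state := stateA_push P h.state h.noSq (by omega) (by rwa [ins_succ h.le]) hd
    (by rw [ins_succ h.le]; exact E.lt_three k)
  noSq := hsq
  le := h.le.trans k.le_succ
  lt_three := h.lt_three
  mark := by
    have := h.le
    change s <<< 7 = _
    rw [h.mark, Nat.shiftLeft_eq, ← pow_add]
    congr 1
    omega
  ne := h.ne
  live p q hq hpq hpn := by
    have hki := h.le
    change (l &&& ((m >>> o) ||| (128 ^ (85 - k) - s))).testBit _ = true
    rw [Nat.testBit_and, h.live p q hq hpq hpn, Bool.true_and, Nat.testBit_or, Bool.or_eq_true]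
    by_cases hlive : k + 1 - i ≤ q - 1 ∧ q - 1 < 85 - k
    · right
      rw [show 128 = 2 ^ 7 from rfl, ← pow_mul, h.mark]
      exact testBit_two_pow_sub_two_pow (by omega) (by omega)
    · left
      have hmem := mem_square E.noSq hq hpq hpn (by omega)
      have hlast : k + 2 < p + 2 * q := by
        by_contra hc
        obtain ⟨t, ht, hne⟩ := hsq p q hq (by omega)
        exact hne (hpq t ht)
      rw [Nat.testBit_shiftRight, ho, ← Nat.add_zero (7 * (q - 1)),
        h.state.masks _ (E.lt_three k) (q - 1) (by omega) 0 (by omega), decide_eq_true_eq]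
      refine ⟨by omega, ?_⟩
      have h1 := hpq (k + 1 - q - p) (by omega)
      rw [show p + (k + 1 - q - p) = k + 1 - q by omega, show k + 1 - q + q = k + 1 by omega,
        ins_succ hki] at h1
      rw [← h1]
      congr 1
      omega

theorem Gaps.step_cons {o k d i s r m l : ℕ} {t : Gaps} {κ : Gaps → Bool} :
    (Gaps.cons i s r m l t).step one comp high o k d κ =
      select(noSqA(runsA(r, m, o)),
        select(Nat.beq liveA(l, m, o, k, s) 0, true,
          t.step one comp high o k d fun t' => κ (.cons i (Nat.shiftLeft s 7) runsA(r, m, o) masksA(m, d) liveA(l, m, o, k, s) t')),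
        t.step one comp high o k d κ) := rfl

theorem Valid.step (P : Params 7 43 96 672 one comp high) {f : ℕ → ℕ} {n k c o d : ℕ} (E : Extremal f n) (hn : n ≤ 86) (hk : k < n)
    (ho : o = 672 * f k) (hd : d = 127 <<< o) (g : Gaps) {b : ℕ} {κ : Gaps → Bool}
    (hg : Valid f n k c b g) (h : g.step one comp high o k d κ = true) :
    ∃ g', Valid f n (k + 1) c b g' ∧ κ g' = true := by
  induction g generalizing b κ with
  | nil => exact ⟨.nil, trivial, h⟩
  | cons i s r m l t ih =>
    obtain ⟨a, hb, hi, hok, ht⟩ := valid_cons.1 hg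
    have hins : ins f i a (k + 1) = f k := ins_succ hok.le
    have hsq := noSqA_iff P (o := o) hok.state hok.noSq (by omega) (by rwa [hins])
      (by rw [hins]; exact E.lt_three k)
    rw [Gaps.step_cons] at h
    cases hc : noSqA(runsA(r, m, o)) with
    | false =>
      rw [hc] at h
      obtain ⟨g', h1, h2⟩ := ih ht h
      exact ⟨g', h1.mono le_rfl (by omega), h2⟩
    | true =>
      rw [hc] at h
      have hok' := hok.step P E hn hk ho hd (hsq.1 hc)
      change select(Nat.beq liveA(l, m, o, k, s) 0, true, _) = true at h
      cases hl : Nat.beq liveA(l, m, o, k, s) 0 with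
      | true =>
        obtain ⟨p, q, h1, h2, h3⟩ := E.exists_square (hok.le.trans hk.le) hok.lt_three
        have := hok'.live p q h1 h2 h3
        rw [Nat.eq_of_beq_eq_true hl, Nat.zero_testBit] at this
        exact absurd this (by decide)
      | false =>
        rw [hl] at h
        obtain ⟨g', h1, h2⟩ := ih ht h
        exact ⟨_, valid_cons.2 ⟨a, hb, hi, hok', h1⟩, h2⟩

theorem Valid.snoc {f : ℕ → ℕ} {n k i a s r m l b : ℕ} {g : Gaps} (hg : Valid f n k i b g)
    (hb : b ≤ 3 * i + a) (h : GapOK f n k i a s r m l) :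
    Valid f n k (i + 1) b (g.snoc i s r m l) := by
  induction g generalizing b with
  | nil => exact ⟨a, hb, i.lt_succ_self, h, trivial⟩
  | cons i' s' r' m' l' t ih =>
    obtain ⟨a', h1, h2, h3, h4⟩ := hg
    have := h3.lt_three
    exact ⟨a', h1, h2.trans i.lt_succ_self, h3, ih h4 (by omega)⟩

theorem square_shift {f : ℕ → ℕ} {i a p q : ℕ} (hi : p ≤ i) (hiq : i < p + q)
    (h : ∀ t < q, ins f i a (p + t) = ins f i a (p + t + q)) :
    (∀ t, i ≤ t → t + 1 < p + q → f t = f (t + q)) ∧ a = f (i + q - 1) := by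
  constructor
  · intro t h1 h2
    have := h (t + 1 - p) (by omega)
    rwa [show p + (t + 1 - p) = t + 1 by omega, show t + 1 + q = t + q + 1 by omega,
      ins_succ h1, ins_succ (by omega)] at this
  · have := h (i - p) (by omega)
    rwa [show p + (i - p) = i by omega, show i + q = i + q - 1 + 1 by omega,
      ins_succ (by omega), ins_self] at this

theorem NoSq.not_two_periods {f : ℕ → ℕ} {n j q q' : ℕ} (hf : NoSq f n) (hq : q < q')
    (hn : j + (q' - q) + q' ≤ n) (h : ∀ t, j ≤ t → t < j + (q' - q) → f t = f (t + q))
    (h' : ∀ t, j ≤ t → t < j + (q' - q) → f t = f (t + q')) : False := by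
  obtain ⟨t, ht, hne⟩ := hf (j + q) (q' - q) (by omega) (by omega)
  have h1 := h (j + t) (by omega) (by omega)
  have h2 := h' (j + t) (by omega) (by omega)
  apply hne
  rw [show j + q + t = j + t + q by omega, show j + t + q + (q' - q) = j + t + q' by omega, ← h1, h2]

theorem NoSq.not_two_insertions {f : ℕ → ℕ} {n i i' a a' p p' q q' : ℕ} (hf : NoSq f n)
    (hn : n ≤ 86) (hi : i ≤ i') (hin : i' ≤ n) (ha : i < i' → a' ≠ f (i' - 1))
    (ha' : i = i' → a ≠ a') (hq : 44 + i' ≤ 2 * q) (hq' : 44 + i' ≤ 2 * q')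
    (h : ∀ t < q, ins f i a (p + t) = ins f i a (p + t + q))
    (h' : ∀ t < q', ins f i' a' (p' + t) = ins f i' a' (p' + t + q'))
    (hp : p + 2 * q ≤ n + 1) (hp' : p' + 2 * q' ≤ n + 1) : False := by
  have hm := mem_square hf (by omega) h hp (by omega)
  have hm' := mem_square hf (by omega) h' hp' hin
  obtain ⟨h1, h2⟩ := square_shift hm.1 (by omega) h
  obtain ⟨hs1, hs2⟩ := square_shift hm'.1 (by omega) h'
  rcases lt_trichotomy q q' with hlt | rfl | hlt
  · exact hf.not_two_periods (j := i') hlt (by omega) (fun t _ _ => h1 t (by omega) (by omega))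
      fun t _ _ => hs1 t (by omega) (by omega)
  · rcases hi.lt_or_eq with hlt | rfl
    · apply ha hlt
      have := h1 (i' - 1) (by omega) (by omega)
      rw [hs2, this]
      congr 1
      omega
    · exact ha' rfl (h2.trans hs2.symm)
  · exact hf.not_two_periods (j := i') hlt (by omega) (fun t _ _ => hs1 t (by omega) (by omega))
      fun t _ _ => h1 t (by omega) (by omega)

theorem le_of_testBit {l e i : ℕ} (h : l.testBit i = true) (hl : l % 2 ^ e = 0) : e ≤ i := by
  by_contra hc
  have := Nat.testBit_mod_two_pow l e i
  rw [hl, Nat.zero_testBit, h, decide_eq_true (not_le.1 hc)] at this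
  exact absurd this (by decide)

theorem Valid.clash_eq_false {f : ℕ → ℕ} {n k c b : ℕ} (E : Extremal f n) (hn : n ≤ 86)
    (hk : k ≤ n) {g : Gaps} (hg : Valid f n k c b g) (h : g.clash = true) : False := by
  match g, hg with
  | .nil, _ => exact absurd h Bool.false_ne_true
  | .cons _ _ _ _ _ .nil, _ => exact absurd h Bool.false_ne_true
  | .cons i s r m l (.cons i' s' r' m' l' t), hg =>
    obtain ⟨a, -, -, hok, hg'⟩ := valid_cons.1 hg
    obtain ⟨a', hlex, -, hok', -⟩ := valid_cons.1 hg'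
    have hmod : (l ||| l') % 2 ^ (7 * ((45 + i') / 2 - 1)) = 0 := by
      rw [pow_mul]
      exact Nat.eq_of_beq_eq_true h
    have := hok.lt_three
    have := hok'.lt_three
    have := hok'.le
    obtain ⟨p, q, h0, h1, h2⟩ := E.exists_square (hok.le.trans hk) hok.lt_three
    obtain ⟨p', q', h0', hs1, hs2⟩ := E.exists_square (hok'.le.trans hk) hok'.lt_three
    have hl := le_of_testBit (l := l ||| l') (i := 7 * (q - 1))
      (by rw [Nat.testBit_or, hok.live p q h0 h1 h2, Bool.true_or]) hmod
    have hl' := le_of_testBit (l := l ||| l') (i := 7 * (q' - 1))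
      (by rw [Nat.testBit_or, hok'.live p' q' h0' hs1 hs2, Bool.or_true]) hmod
    exact E.noSq.not_two_insertions hn (by omega) (by omega) (fun hi => hok'.ne (by omega))
      (by omega) (by omega) (by omega) h1 hs1 h2 hs2

/-- What holds for the arguments of the search after reading `k` letters. -/
structure Reached (f : ℕ → ℕ) (n k p r m : ℕ) (g : Gaps) : Prop where
  pos : 0 < k
  last : p = 672 * f (k - 1)
  state : State 7 43 96 672 f k r m
  valid : Valid f n k k 0 g

theorem child_sound (P : Params 7 43 96 672 one comp high)
    (hfull : ∀ j < 43, full.testBit (7 * j) = true) {f : ℕ → ℕ} {n k p r m o a a' d e : ℕ}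
    {g : Gaps} {next : ℕ → ℕ → ℕ → ℕ → Gaps → Bool}
    (E : Extremal f n) (hn : n ≤ 86) (hk : k < n) (R : Reached f n k p r m g) (ho : o = 672 * f k)
    (ha : a = 672 * a') (ha3 : a' < 3) (hd : d = 127 <<< o) (he : e = 127 <<< a)
    (ha' : a' ≠ f (k - 1)) (h : child one comp high full next k r m g o a d e = true) :
    ∃ p r m g, Reached f n (k + 1) p r m g ∧ next (k + 1) p r m g = true := by
  have hfk := E.noSq.mono hk.le
  have hcongr : ∀ t < k, f t = ins f k a' t := fun t ht => (ins_of_lt ht).symm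
  have hsq := noSqA_iff P (o := a) (R.state.congr hcongr) (hfk.congr hcongr) (by omega)
    (by rw [ins_self, ha]) (by rwa [ins_self])
  have hst := stateA_push P (o := a) (d := e) (R.state.congr hcongr) (hfk.congr hcongr) (by omega)
    (by rw [ins_self, ha]) he (by rwa [ins_self])
  have hvalid : Valid f n k (k + 1) 0 (@Bool.rec (fun _ => Gaps) g
      (g.snoc k 128 runsA(r, m, a) masksA(m, e) full) noSqA(runsA(r, m, a))) := by
    cases hc : noSqA(runsA(r, m, a)) with
    | false => exact R.valid.mono k.le_succ le_rfl
    | true =>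
      refine R.valid.snoc (a := a') (Nat.zero_le _) ⟨hst, hsq.1 hc, le_rfl, ha3, ?_, fun _ => ha', ?_⟩
      · rw [Nat.add_sub_cancel_left]
        rfl
      · exact fun p q _ _ _ => hfull (q - 1) (by omega)
  obtain ⟨g', h1, h2⟩ := Valid.step P E hn hk ho hd _ hvalid h
  change select(g'.clash, true, next (k + 1) o runsA(r, m, o) masksA(m, d) g') = true at h2
  cases hc : g'.clash with
  | true => exact (h1.clash_eq_false E hn hk hc).elim
  | false =>
    rw [hc] at h2
    exact ⟨o, _, _, g', ⟨k.succ_pos, ho, stateA_push P R.state hfk (by omega) ho hd (E.lt_three k), h1⟩,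
      h2⟩

theorem NoSq.ne_pred {f : ℕ → ℕ} {n k : ℕ} (h : NoSq f n) (hk : k < n) (hk0 : 0 < k) :
    f k ≠ f (k - 1) := by
  obtain ⟨t, ht, hne⟩ := h (k - 1) 1 one_pos (by omega)
  obtain rfl : t = 0 := by omega
  rw [Nat.add_zero, Nat.sub_add_cancel hk0] at hne
  exact hne.symm

theorem noSqA_self (P : Params 7 43 96 672 one comp high) {f : ℕ → ℕ} {n k p r m o : ℕ} {g : Gaps}
    (E : Extremal f n) (hn : n ≤ 86) (hk : k < n) (R : Reached f n k p r m g) (ho : o = 672 * f k) :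
    noSqA(runsA(r, m, o)) = true :=
  (noSqA_iff P R.state (E.noSq.mono hk.le) (by omega) ho (E.lt_three k)).2 (E.noSq.mono hk)

theorem branch_end (P : Params 7 43 96 672 one comp high) {f : ℕ → ℕ} {n p r m x y x' y' dx dy : ℕ}
    {g : Gaps} {next : ℕ → ℕ → ℕ → ℕ → Gaps → Bool}
    (E : Extremal f n) (hn : n ≤ 86) (R : Reached f n n p r m g) (hx : x = 672 * x')
    (hy : y = 672 * y') (hx3 : x' < 3) (hy3 : y' < 3)
    (h : branch one comp high full next n r m g x y dx dy = true) : okLength n = true := by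
  have hsq : ∀ z z', z = 672 * z' → z' < 3 → noSqA(runsA(r, m, z)) = false := by
    intro z z' hz hz3
    have hcongr : ∀ t < n, f t = ins f n z' t := fun t ht => (ins_of_lt ht).symm
    rw [← Bool.not_eq_true, noSqA_iff P (R.state.congr hcongr) (E.noSq.congr hcongr) hn
      (by rwa [ins_self]) (by rwa [ins_self])]
    exact E.ext n le_rfl z' hz3
  rw [branch, hsq x x' hx hx3, hsq y y' hy hy3] at h
  cases g with
  | nil => exact h
  | cons i s r m l t =>
    obtain ⟨a, -, -, hok, -⟩ := valid_cons.1 R.valid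
    exact absurd hok.noSq (E.ext i hok.le a hok.lt_three)

theorem branch_sound (P : Params 7 43 96 672 one comp high)
    (hfull : ∀ j < 43, full.testBit (7 * j) = true) {f : ℕ → ℕ} {n k p r m x y x' y' dx dy : ℕ}
    {g : Gaps} {next : ℕ → ℕ → ℕ → ℕ → Gaps → Bool}
    (E : Extremal f n) (hn : n ≤ 86) (hk : k < n) (R : Reached f n k p r m g) (hx : x = 672 * x')
    (hy : y = 672 * y') (hdx : dx = 127 <<< x) (hdy : dy = 127 <<< y) (hxy : x' < y')
    (hy3 : y' < 3) (hx' : x' ≠ f (k - 1)) (hy' : y' ≠ f (k - 1))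
    (h : branch one comp high full next k r m g x y dx dy = true) :
    ∃ p r m g, Reached f n (k + 1) p r m g ∧ next (k + 1) p r m g = true := by
  have hne := E.noSq.ne_pred hk R.pos
  have h3 := E.lt_three (k - 1)
  have h3' := E.lt_three k
  have hself : ∀ z, z = 672 * f k → noSqA(runsA(r, m, z)) = true :=
    fun z => noSqA_self P E hn hk R
  rw [branch] at h
  rcases (by omega : f k = x' ∨ f k = y') with hf | hf
  · rw [hself x (by rw [hx, hf])] at h
    change select(child one comp high full next k r m g x y dx dy, _, false) = true at h
    cases hc : child one comp high full next k r m g x y dx dy with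
    | false =>
      rw [hc] at h
      exact absurd h Bool.false_ne_true
    | true => exact child_sound P hfull E hn hk R (by rw [hx, hf]) hy (by omega) hdx hdy hy' hc
  · rw [hself y (by rw [hy, hf])] at h
    have hc : child one comp high full next k r m g y x dy dx = true := by
      cases hx0 : noSqA(runsA(r, m, x)) with
      | false =>
        rw [hx0] at h
        exact h
      | true =>
        rw [hx0] at h
        change select(child one comp high full next k r m g x y dx dy,
          child one comp high full next k r m g y x dy dx, false) = true at h
        cases hc : child one comp high full next k r m g x y dx dy with
        | false =>
          rw [hc] at h
          exact absurd h Bool.false_ne_true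
        | true =>
          rw [hc] at h
          exact h
    exact child_sound P hfull E hn hk R (by rw [hy, hf]) hx (by omega) hdy hdx hx' hc

theorem follow_sound (P : Params 7 43 96 672 one comp high)
    (hfull : ∀ j < 43, full.testBit (7 * j) = true) {f : ℕ → ℕ} {n b k p r m x y x' y' dx dy : ℕ}
    {g : Gaps} {next : ℕ → ℕ → ℕ → ℕ → Gaps → Bool}
    (E : Extremal f n) (hn : n ≤ 86) (hk : k < n) (R : Reached f n k p r m g) (hx : x = 672 * x')
    (hy : y = 672 * y') (hdx : dx = 127 <<< x) (hdy : dy = 127 <<< y) (hxy : x' < y')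
    (hy3 : y' < 3) (hx' : x' ≠ f (k - 1)) (hy' : y' ≠ f (k - 1))
    (hb : b.testBit 0 = decide (3 - f (k - 1) - f k < f k))
    (h : follow one comp high full next b k r m g x y dx dy = true) :
    ∃ p r m g, Reached f n (k + 1) p r m g ∧ next (k + 1) p r m g = true := by
  have hne := E.noSq.ne_pred hk R.pos
  have h3 := E.lt_three (k - 1)
  have h3' := E.lt_three k
  have hself : ∀ z, z = 672 * f k → noSqA(runsA(r, m, z)) = true :=
    fun z => noSqA_self P E hn hk R
  rw [follow] at h
  rcases (by omega : f k = x' ∨ f k = y') with hf | hf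
  · have hb0 : Nat.beq (Nat.mod b 2) 0 = true := by
      rw [decide_eq_false (by omega), Nat.testBit_zero, decide_eq_false_iff_not] at hb
      have h0 : b % 2 = 0 := by omega
      change Nat.beq (b % 2) 0 = true
      rw [h0]
      rfl
    rw [hb0, hself x (by rw [hx, hf])] at h
    exact child_sound P hfull E hn hk R (by rw [hx, hf]) hy (by omega) hdx hdy hy' h
  · have hb0 : Nat.beq (Nat.mod b 2) 0 = false := by
      rw [decide_eq_true (by omega), Nat.testBit_zero, decide_eq_true_eq] at hb
      change Nat.beq (b % 2) 0 = false
      rw [hb]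
      rfl
    rw [hb0, hself y (by rw [hy, hf])] at h
    exact child_sound P hfull E hn hk R (by rw [hy, hf]) hx (by omega) hdy hdx hx' h

theorem others_sound {c p : ℕ} (hc : c < 3) (hp : p = 672 * c) (hdB : dB = 127 <<< 672)
    (hdC : dC = 127 <<< 1344) {F : ℕ → ℕ → ℕ → ℕ → Bool} {G : Prop}
    (hF : ∀ x y x' y' dx dy, x = 672 * x' → y = 672 * y' → dx = 127 <<< x → dy = 127 <<< y →
      x' < y' → y' < 3 → x' ≠ c → y' ≠ c → F x y dx dy = true → G)
    (h : others(F, p) = true) : G := by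
  subst hp
  interval_cases c
  · exact hF 672 1344 1 2 dB dC rfl rfl hdB hdC (by decide) (by decide) (by decide) (by decide) h
  · exact hF 0 1344 0 2 127 dC rfl rfl rfl hdC (by decide) (by decide) (by decide) (by decide) h
  · exact hF 0 672 0 1 127 dB rfl rfl rfl hdB (by decide) (by decide) (by decide) (by decide) h

theorem search_sound (P : Params 7 43 96 672 one comp high)
    (hfull : ∀ j < 43, full.testBit (7 * j) = true) (hdB : dB = 127 <<< 672)
    (hdC : dC = 127 <<< 1344) {f : ℕ → ℕ} {n : ℕ} (E : Extremal f n) (hn : n ≤ 86)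
    (fuel : ℕ) {k p r m : ℕ} {g : Gaps} (R : Reached f n k p r m g) (hk : k ≤ n)
    (hkn : n < k + fuel) (h : search one comp high full dB dC fuel k p r m g = true) :
    okLength n = true := by
  induction fuel generalizing k p r m g with
  | zero => omega
  | succ fuel ih =>
    refine others_sound (E.lt_three (k - 1)) R.last hdB hdC ?_ h
    intro x y x' y' dx dy hx hy hdx hdy hxy hy3 hx' hy' h
    rcases hk.lt_or_eq with hlt | rfl
    · obtain ⟨p, r, m, g, R', h'⟩ :=
        branch_sound P hfull E hn hlt R hx hy hdx hdy hxy hy3 hx' hy' h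
      exact ih R' hlt (by omega) h'
    · exact branch_end P E hn R hx hy (hxy.trans hy3) hy3 h

theorem searchPath_sound (P : Params 7 43 96 672 one comp high)
    (hfull : ∀ j < 43, full.testBit (7 * j) = true) (hdB : dB = 127 <<< 672)
    (hdC : dC = 127 <<< 1344) {f : ℕ → ℕ} {n : ℕ} (E : Extremal f n) (hn : n ≤ 86)
    (fuel D : ℕ) {b k p r m : ℕ} {g : Gaps} (R : Reached f n k p r m g) (hk : k + D ≤ n)
    (hkn : n < k + D + fuel)
    (hb : ∀ j < D, b.testBit j = decide (3 - f (k + j - 1) - f (k + j) < f (k + j)))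
    (h : searchPath one comp high full dB dC fuel D b k p r m g = true) : okLength n = true := by
  induction D generalizing b k p r m g with
  | zero => exact search_sound P hfull hdB hdC E hn fuel R hk hkn h
  | succ D ih =>
    have hpos := R.pos
    refine others_sound (E.lt_three (k - 1)) R.last hdB hdC ?_ h
    intro x y x' y' dx dy hx hy hdx hdy hxy hy3 hx' hy' h
    obtain ⟨p, r, m, g, R', h'⟩ :=
      follow_sound P hfull E hn (by omega) R hx hy hdx hdy hxy hy3 hx' hy' (hb 0 D.succ_pos) h
    refine ih R' (by omega) (by omega) (fun j hj => ?_) h'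
    have := hb (j + 1) (by omega)
    rw [Nat.testBit_succ] at this
    rw [show k + 1 + j = k + (j + 1) by omega]
    exact this

end

local notation "oneA" => 32079306713928914744384971471013829307897140057731279537577014950462697634068294585565313
local notation "compA" => 673918033958758618409599243186337768452516296645882313435082487305783285729875668931403583
local notation "highA" => 2053075629691450543640638174144885075705416963694801890404928956829612648580370853476180032
local notation "fullA" => 4074071952668972172536891376818756322102936787331872501272280898708762599526673412366794751
local notation "maskB" => 2488632721813929957969508003912032919097293745571907908306575099713090746088807524772121198874912162519346315580362951940124734847893353889201702460172730937392687075709225475677629177463460658093743931392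
local notation "maskC" => 48766085229000073178524619323574860803148356979954187010083500496663651414913293047057952804048701147600817875986138759686637004530766524788252147996132773313915037242064864479534773812867028158397299670575138209430814394247577334397028219172439109542277542086356119620872341108235652582799003414653986009188386025789661314341114135851252285084545206642269070497266481782654977610213078973813201140377976832
local notation "start(" S ")" => S 2 672 0 2488632721813929957969508003912032919097293745571907908306575099713090746088807524772121198874912162519346315580362951940124734847893353889201702460172730937392687075709225475677629177463460658093743947648 (Gaps.cons 0 2097152 128 40776247146921242361330388644098659379409158021195711077603233008798991874665111293391205843565435782879489380784246967538943780482732603474569894809930196409179177735495659418977954072738802882865994315874176 4074071952668972172536891376818756322102936787331872501272280898708762599526673412366794751 (Gaps.cons 0 2097152 0 798983540391937198956947362997450519398782680759569399973208072137337264781939393282997498741533919602291800080156897438705860682232078742130723192768639357975183970173990739632697734150013389347181357802705553056036276965310276554764822375840339664486247157451165238968085527463421739441350993144565818937061862962118173926104938736634810792714390368087109181964606724602728378641408715084418948142046516363136 4074071952668972172536891376818756322102936787331872501272280898708762599526673412366794751 (Gaps.cons 1 16384 0 6242058909312009366851151273417582182802989693434135937290688063572947381108901510023417958918233746892904688126225761239889536579938115172896274943504994984181124766984302653380451048046979604274854357836106323528958172421659406806731644973169499766983433295360158411184750407942971055370393635950622371695459726881439600175787344236853646380023488910383171961042796743889062609784903286111550404062127046656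 4074071952668972172536891376818756322102936787331872501272280898708762599526673412366794751 Gaps.nil)))

/-- Search along the `n` paths of length `D` numbered `a, a + d, a + 2 * d, …`. -/
noncomputable def searchRange (D d a n : ℕ) : Bool :=
  @Nat.rec (fun _ => Bool) true (fun i ih =>
    and start((searchPath oneA compA highA fullA maskB maskC (Nat.sub 85 D) D
      (Nat.add a (Nat.mul d i)))) ih) n

theorem search_short : start((search oneA compA highA fullA maskB maskC 20)) = true := by
  decide +kernel

theorem searchRange_10_0 : searchRange 10 1 0 305 = true := by decide +kernel

theorem searchRange_10_305 : searchRange 10 1 305 61 = true := by decide +kernel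

theorem searchRange_10_366 : searchRange 10 1 366 32 = true := by decide +kernel

theorem searchRange_20_398 : searchRange 20 1024 398 406 = true := by decide +kernel

theorem searchRange_20_416142 : searchRange 20 1024 416142 164 = true := by decide +kernel

theorem searchRange_20_584078 : searchRange 20 1024 584078 32 = true := by decide +kernel

theorem searchRange_20_616846 : searchRange 20 1024 616846 60 = true := by decide +kernel

theorem searchRange_20_678286 : searchRange 20 1024 678286 140 = true := by decide +kernel

theorem searchRange_20_821646 : searchRange 20 1024 821646 222 = true := by decide +kernel

theorem searchRange_10_399 : searchRange 10 1 399 23 = true := by decide +kernel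

theorem searchRange_20_422 : searchRange 20 1024 422 473 = true := by decide +kernel

theorem searchRange_20_484774 : searchRange 20 1024 484774 152 = true := by decide +kernel

theorem searchRange_20_640422 : searchRange 20 1024 640422 399 = true := by decide +kernel

theorem searchRange_10_423 : searchRange 10 1 423 202 = true := by decide +kernel

theorem searchRange_20_625 : searchRange 20 1024 625 285 = true := by decide +kernel

theorem searchRange_20_292465 : searchRange 20 1024 292465 448 = true := by decide +kernel

theorem searchRange_20_751217 : searchRange 20 1024 751217 200 = true := by decide +kernel

theorem searchRange_20_956017 : searchRange 20 1024 956017 91 = true := by decide +kernel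

theorem searchRange_10_626 : searchRange 10 1 626 97 = true := by decide +kernel

theorem searchRange_10_723 : searchRange 10 1 723 211 = true := by decide +kernel

theorem searchRange_20_934 : searchRange 20 1024 934 664 = true := by decide +kernel

theorem searchRange_20_680870 : searchRange 20 1024 680870 1 = true := by decide +kernel

theorem searchRange_20_681894 : searchRange 20 1024 681894 359 = true := by decide +kernel

theorem searchRange_10_935 : searchRange 10 1 935 89 = true := by decide +kernel

theorem paramsA : Params 7 43 96 672 oneA compA highA where
  hK := rfl
  hQJ := by decide
  hB := by decide
  hQ := by decide
  hone := by decide +kernel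
  hC := by decide +kernel
  hH := by decide +kernel

theorem fullA_testBit : ∀ j < 43, (fullA).testBit (7 * j) = true := by decide +kernel

theorem searchRange_sound {D d a n i : ℕ} (h : searchRange D d a n = true) (hi : i < n) :
    start((searchPath oneA compA highA fullA maskB maskC (85 - D) D (a + d * i))) = true := by
  induction n with
  | zero => omega
  | succ n ih =>
    obtain ⟨h1, h2⟩ := (Bool.and_eq_true _ _).mp h
    rcases Nat.lt_succ_iff_lt_or_eq.1 hi with h3 | rfl
    · exact ih h2 h3
    · exact h1

theorem NoSq.succ_of_ne {f : ℕ → ℕ} {k : ℕ} (h : NoSq f k) (hk : k < 3)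
    (hne : 0 < k → f k ≠ f (k - 1)) : NoSq f (k + 1) := by
  intro s q hq hs
  obtain rfl : q = 1 := by omega
  by_cases h1 : s + 1 = k
  · subst h1
    exact ⟨0, one_pos, (hne s.succ_pos).symm⟩
  · exact h s 1 hq (by omega)

theorem noSq_zero {f : ℕ → ℕ} : NoSq f 0 := fun s q hq hs => by omega

theorem State.of_eq {B Q J K : ℕ} {f : ℕ → ℕ} {k r m r' m' : ℕ} (h : State B Q J K f k r m)
    (hr : r = r') (hm : m = m') : State B Q J K f k r' m' := hr ▸ hm ▸ h

theorem NoSq.of_three {f : ℕ → ℕ} (h1 : f 1 ≠ f 0) (h2 : f 2 ≠ f 1) : NoSq f 3 :=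
  ((noSq_zero.succ_of_ne (by decide) fun h => absurd h (by decide)).succ_of_ne (by decide)
    fun _ => h1).succ_of_ne (by decide) fun _ => h2

/-- The detector state after reading `k` letters of `f`. -/
def readA (f : ℕ → ℕ) : ℕ → ℕ × ℕ
  | 0 => (0, 0)
  | k + 1 => (((readA f k).1 + oneA) &&& ((readA f k).2 >>> (672 * f k)),
      ((readA f k).2 <<< 7) ||| (127 <<< (672 * f k)))

theorem state_readA {f : ℕ → ℕ} {k : ℕ} (hf : NoSq f k) (hk : k ≤ 96) (h3 : ∀ i, f i < 3) :
    State 7 43 96 672 f k (readA f k).1 (readA f k).2 := by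
  induction k with
  | zero => exact .zero
  | succ k ih =>
    exact (ih (hf.mono k.le_succ) (by omega)).push paramsA (hf.mono k.le_succ) hk rfl (h3 k)

theorem state_three {g : ℕ → ℕ} {r m x y z : ℕ} (h0 : g 0 = x) (h1 : g 1 = y) (h2 : g 2 = z)
    (hxy : y ≠ x) (hyz : z ≠ y) (h3 : ∀ i, g i < 3)
    (hr : readA (fun i => [x, y, z].getD i 0) 3 = (r, m)) :
    State 7 43 96 672 g 3 r m := by
  have hg : ∀ t < 3, [x, y, z].getD t 0 = g t := by
    intro t ht
    interval_cases t <;> simp [h0, h1, h2]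
  have hsq : NoSq (fun i => [x, y, z].getD i 0) 3 := NoSq.of_three hxy hyz
  have h3' : ∀ i, [x, y, z].getD i 0 < 3 := by
    intro i
    rcases Nat.lt_or_ge i 3 with hi | hi
    · rw [hg i hi]
      exact h3 i
    · rw [List.getD_eq_default _ _ (by simpa using hi)]
      decide
  have := (state_readA hsq (by decide) h3').congr hg
  rwa [hr] at this

theorem gapOK_start {f : ℕ → ℕ} {n i a s r m x y z : ℕ} (hn : n ≤ 86)
    (h0 : ins f i a 0 = x) (h1 : ins f i a 1 = y) (h2 : ins f i a 2 = z) (hxy : y ≠ x)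
    (hyz : z ≠ y) (h3 : ∀ i, f i < 3) (hi : i ≤ 2) (ha : a < 3)
    (hs : s = 2 ^ (7 * (2 + 1 - i))) (hne : 0 < i → a ≠ f (i - 1))
    (hr : readA (fun i => [x, y, z].getD i 0) 3 = (r, m)) :
    GapOK f n 2 i a s r m fullA where
  state := by
    refine state_three h0 h1 h2 hxy hyz (fun t => ?_) hr
    rw [ins]
    split_ifs
    exacts [h3 _, ha, h3 _]
  noSq := NoSq.of_three (by rwa [h0, h1]) (by rwa [h1, h2])
  le := hi
  lt_three := ha
  mark := hs
  ne := hne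
  live p q hq _ hp := fullA_testBit (q - 1) (by omega)

theorem of_start {f : ℕ → ℕ} {n : ℕ} (E : Extremal f n) (hn : n ≤ 86) (h0 : f 0 = 0)
    (h1 : f 1 = 1) {S : ℕ → ℕ → ℕ → ℕ → Gaps → Bool} (h : start(S) = true) :
    ∃ p r m g, Reached f n 2 p r m g ∧ S 2 p r m g = true := by
  refine ⟨_, _, _, _, ⟨two_pos, by rw [h1], ?_, ?_⟩, h⟩
  · have hg : ∀ t < 2, [0, 1].getD t 0 = f t := by
      intro t ht
      interval_cases t <;> simp [h0, h1]
    have hsq : NoSq (fun i => [0, 1].getD i 0) 2 :=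
      (noSq_zero.succ_of_ne (by decide) fun h => absurd h (by decide)).succ_of_ne (by decide)
        fun _ => by decide
    have h3' : ∀ i, [0, 1].getD i 0 < 3 := by
      rintro (_ | _ | i) <;> simp
    exact ((state_readA hsq (by decide) h3').congr hg).of_eq (by decide +kernel) (by decide +kernel)
  · refine valid_cons.2 ⟨1, by decide, by decide, gapOK_start (x := 1) (y := 0) (z := 1) hn ?_ ?_ ?_
      (by decide) (by decide) E.lt_three (by decide) (by decide) (by decide) ?_ (by decide +kernel),
      valid_cons.2 ⟨2, by decide, by decide, gapOK_start (x := 2) (y := 0) (z := 1) hn ?_ ?_ ?_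
      (by decide) (by decide) E.lt_three (by decide) (by decide) (by decide) ?_ (by decide +kernel),
      valid_cons.2 ⟨2, by decide, by decide, gapOK_start (x := 0) (y := 2) (z := 1) hn ?_ ?_ ?_
      (by decide) (by decide) E.lt_three (by decide) (by decide) (by decide) ?_ (by decide +kernel),
      trivial⟩⟩⟩ <;> simp [ins, h0, h1]

theorem Extremal.okLength_of_start {f : ℕ → ℕ} {n D b : ℕ} (E : Extremal f n) (hn : n ≤ 86)
    (h0 : f 0 = 0) (h1 : f 1 = 1) (hD : 2 + D ≤ n) (hD' : D ≤ 85)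
    (hb : ∀ j < D, b.testBit j = decide (3 - f (2 + j - 1) - f (2 + j) < f (2 + j)))
    (h : start((searchPath oneA compA highA fullA maskB maskC (85 - D) D b)) = true) :
    okLength n = true := by
  obtain ⟨p, r, m, g, R, h⟩ := of_start E hn h0 h1 h
  exact searchPath_sound paramsA fullA_testBit (by decide +kernel) (by decide +kernel) E hn _ D R hD
    (by omega) hb h

theorem Extremal.okLength_of_start_zero_one {f : ℕ → ℕ} {n : ℕ} (E : Extremal f n) (hn : n ≤ 86)
    (h2 : 2 ≤ n) (h0 : f 0 = 0) (h1' : f 1 = 1) : okLength n = true := by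
  rcases Nat.lt_or_ge n 22 with hlt | hge
  · obtain ⟨p, r, m, g, R, h⟩ := of_start E hn h0 h1' search_short
    exact search_sound paramsA fullA_testBit (by decide +kernel) (by decide +kernel) E hn _ R h2
      hlt h
  let v : Fin 20 → Bool := fun j => decide (3 - f (2 + j - 1) - f (2 + j) < f (2 + j))
  obtain ⟨b, hb, hbv⟩ : ∃ b < 1024 * 1024, ∀ j < 20,
      b.testBit j = decide (3 - f (2 + j - 1) - f (2 + j) < f (2 + j)) :=
    ⟨Nat.ofBits v, Nat.ofBits_lt_two_pow v, fun j hj => Nat.testBit_ofBits_lt v j hj⟩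
  have hten : ∀ {a m}, searchRange 10 1 a m = true → a ≤ b % 1024 → b % 1024 < a + m →
      okLength n = true := by
    intro a m h h1 h2
    have := searchRange_sound (i := b % 1024 - a) h (by omega)
    rw [one_mul, Nat.add_sub_cancel' h1] at this
    refine E.okLength_of_start hn h0 h1' (by omega) (by decide) (fun j hj => ?_) this
    rw [← hbv j (by omega), show 1024 = 2 ^ 10 from rfl, Nat.testBit_mod_two_pow, decide_eq_true hj,
      Bool.true_and]
  have htwenty : ∀ {a m c}, searchRange 20 1024 a m = true → b % 1024 = c → a % 1024 = c ∧ a ≤ b →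
      b < a + 1024 * m → okLength n = true := by
    intro a m c h hc h1 h2
    have := searchRange_sound (i := (b - a) / 1024) h (by omega)
    rw [show a + 1024 * ((b - a) / 1024) = b by omega] at this
    exact E.okLength_of_start hn h0 h1' (by omega) (by decide) hbv this
  rcases Nat.lt_or_ge (b % 1024) 305 with h | h
  · exact hten searchRange_10_0 (by omega) h
  rcases Nat.lt_or_ge (b % 1024) 366 with h | h
  · exact hten searchRange_10_305 (by omega) h
  rcases Nat.lt_or_ge (b % 1024) 398 with h | h
  · exact hten searchRange_10_366 (by omega) h
  rcases Nat.lt_or_ge (b % 1024) 399 with h | h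
  · have h_mod : b % 1024 = 398 := by omega
    rcases Nat.lt_or_ge b 416142 with h | h
    · exact htwenty searchRange_20_398 h_mod (by omega) h
    rcases Nat.lt_or_ge b 584078 with h | h
    · exact htwenty searchRange_20_416142 h_mod (by omega) h
    rcases Nat.lt_or_ge b 616846 with h | h
    · exact htwenty searchRange_20_584078 h_mod (by omega) h
    rcases Nat.lt_or_ge b 678286 with h | h
    · exact htwenty searchRange_20_616846 h_mod (by omega) h
    rcases Nat.lt_or_ge b 821646 with h | h
    · exact htwenty searchRange_20_678286 h_mod (by omega) h
    exact htwenty searchRange_20_821646 h_mod (by omega) (by omega)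
  rcases Nat.lt_or_ge (b % 1024) 422 with h | h
  · exact hten searchRange_10_399 (by omega) h
  rcases Nat.lt_or_ge (b % 1024) 423 with h | h
  · have h_mod : b % 1024 = 422 := by omega
    rcases Nat.lt_or_ge b 484774 with h | h
    · exact htwenty searchRange_20_422 h_mod (by omega) h
    rcases Nat.lt_or_ge b 640422 with h | h
    · exact htwenty searchRange_20_484774 h_mod (by omega) h
    exact htwenty searchRange_20_640422 h_mod (by omega) (by omega)
  rcases Nat.lt_or_ge (b % 1024) 625 with h | h
  · exact hten searchRange_10_423 (by omega) h
  rcases Nat.lt_or_ge (b % 1024) 626 with h | h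
  · have h_mod : b % 1024 = 625 := by omega
    rcases Nat.lt_or_ge b 292465 with h | h
    · exact htwenty searchRange_20_625 h_mod (by omega) h
    rcases Nat.lt_or_ge b 751217 with h | h
    · exact htwenty searchRange_20_292465 h_mod (by omega) h
    rcases Nat.lt_or_ge b 956017 with h | h
    · exact htwenty searchRange_20_751217 h_mod (by omega) h
    exact htwenty searchRange_20_956017 h_mod (by omega) (by omega)
  rcases Nat.lt_or_ge (b % 1024) 723 with h | h
  · exact hten searchRange_10_626 (by omega) h
  rcases Nat.lt_or_ge (b % 1024) 934 with h | h
  · exact hten searchRange_10_723 (by omega) h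
  rcases Nat.lt_or_ge (b % 1024) 935 with h | h
  · have h_mod : b % 1024 = 934 := by omega
    rcases Nat.lt_or_ge b 680870 with h | h
    · exact htwenty searchRange_20_934 h_mod (by omega) h
    rcases Nat.lt_or_ge b 681894 with h | h
    · exact htwenty searchRange_20_680870 h_mod (by omega) h
    exact htwenty searchRange_20_681894 h_mod (by omega) (by omega)
  exact hten searchRange_10_935 (by omega) (by omega)

/-! ### Reading explicit words -/

/-- The letter number `t` of the word encoded by `c` in base `4`. -/
def digit (c t : ℕ) : ℕ := c / 4 ^ t % 4

/-- The concatenation of the first `p` letters of `f` and of `g`. -/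
def append (p : ℕ) (f g : ℕ → ℕ) (t : ℕ) : ℕ := if t < p then f t else g (t - p)

/-- The image of `u` under a substitution by words of length `32`. -/
def blocks (X u : ℕ → ℕ) (t : ℕ) : ℕ := digit (X (u (t / 32))) (t % 32)

/-- The image of the first `k` letters of `u` between the words encoded by `L` and `R`. -/
def frame (X : ℕ → ℕ) (L p R : ℕ) (u : ℕ → ℕ) (k : ℕ) : ℕ → ℕ :=
  append p (digit L) (append (32 * k) (blocks X u) (digit R))

/-- The word encoded by `c` is ternary of length at most `n`. -/
noncomputable def ternary (n : ℕ) : ℕ → Bool :=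
  Nat.rec (motive := fun _ => ℕ → Bool) (fun c => Nat.beq c 0)
    (fun _ ih c => select(Nat.beq (Nat.mod c 4) 3, false, ih (Nat.div c 4))) n

section

variable (one comp high : ℕ) (X : ℕ → ℕ)

local notation "runsB(" r "," m "," o ")" => Nat.land (Nat.add r one) (Nat.shiftRight m o)
local notation "masksB(" m "," o ")" => Nat.lor (Nat.shiftLeft m 9) (Nat.shiftLeft 511 o)
local notation "noSqB(" r ")" => Nat.beq (Nat.land (Nat.add r comp) high) 0
local notation "offset(" c ")" => Nat.mul 3600 (Nat.mod c 4)

/-- Read the `n` first letters of the word encoded by `c`, failing when a square appears. -/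
noncomputable def read (n : ℕ) : ℕ → ℕ → ℕ → (ℕ → ℕ → Bool) → Bool :=
  Nat.rec (motive := fun _ => ℕ → ℕ → ℕ → (ℕ → ℕ → Bool) → Bool) (fun _ r m κ => κ r m)
    (fun _ ih c r m κ => select(noSqB(runsB(r, m, offset(c))),
      ih (Nat.div c 4) runsB(r, m, offset(c)) masksB(m, offset(c)) κ, false)) n

/-- A square appears when the `n` first letters of the word encoded by `c` are read. -/
noncomputable def hasSquare (n : ℕ) : ℕ → ℕ → ℕ → Bool :=
  Nat.rec (motive := fun _ => ℕ → ℕ → ℕ → Bool) (fun _ _ _ => false)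
    (fun _ ih c r m => select(noSqB(runsB(r, m, offset(c))),
      ih (Nat.div c 4) runsB(r, m, offset(c)) masksB(m, offset(c)), true)) n

/-- Every insertion of a letter at one of the `n` first positions creates a square; here `c` encodes
the remaining `N` letters. -/
noncomputable def insertions (n : ℕ) : ℕ → ℕ → ℕ → ℕ → Bool :=
  Nat.rec (motive := fun _ => ℕ → ℕ → ℕ → ℕ → Bool) (fun _ _ _ _ => true)
    (fun _ ih N c r m =>
      select(hasSquare one comp high (Nat.succ N) (Nat.mul 4 c) r m,
        select(hasSquare one comp high (Nat.succ N) (Nat.add 1 (Nat.mul 4 c)) r m,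
          select(hasSquare one comp high (Nat.succ N) (Nat.add 2 (Nat.mul 4 c)) r m,
            ih (Nat.pred N) (Nat.div c 4) runsB(r, m, offset(c)) masksB(m, offset(c)),
            false), false), false)) n

/-- The word of length `N` encoded by `c` is square-free and every insertion of a letter at
positions `i, …, i + n - 1` creates a square. -/
noncomputable def insertionsCheck (i n N c : ℕ) : Bool :=
  select(read one comp high N c 0 0 (fun _ _ => true),
    read one comp high i c 0 0
      (insertions one comp high n (Nat.sub N i) (Nat.div c (Nat.pow 4 i))), false)

/-- Read the images under `X` of all square-free words with `n` more letters; the letters read so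
far lead to `r` and `m`, their preimage leads to `r'` and `m'`. -/
noncomputable def tree (κ : ℕ → ℕ → Bool) (n : ℕ) : ℕ → ℕ → ℕ → ℕ → Bool :=
  Nat.rec (motive := fun _ => ℕ → ℕ → ℕ → ℕ → Bool) (fun r m _ _ => κ r m)
    (fun _ ih r m r' m' =>
      select(select(noSqB(runsB(r', m', 0)), read one comp high 32 (X 0) r m
          (fun r m => ih r m runsB(r', m', 0) masksB(m', 0)), true),
        select(select(noSqB(runsB(r', m', 3600)), read one comp high 32 (X 1) r m
            (fun r m => ih r m runsB(r', m', 3600) masksB(m', 3600)), true),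
          select(noSqB(runsB(r', m', 7200)), read one comp high 32 (X 2) r m
            (fun r m => ih r m runsB(r', m', 7200) masksB(m', 7200)), true),
          false), false)) n

/-- The images of all square-free words of length `9`, framed by `L` and `R`, are square-free. -/
noncomputable def treeCheck (L p R l : ℕ) : Bool :=
  read one comp high p L 0 0 fun r m =>
    tree one comp high X (fun r m => read one comp high l R r m fun _ _ => true) 9 r m 0 0

/-- Read the images of the letters of the word encoded by `u`, each time followed by `R`. -/
noncomputable def prefixes (R l n : ℕ) : ℕ → ℕ → ℕ → Bool :=
  Nat.rec (motive := fun _ => ℕ → ℕ → ℕ → Bool) (fun _ _ _ => true)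
    (fun _ ih u r m => read one comp high 32 (X (Nat.mod u 4)) r m fun r m =>
      select(read one comp high l R r m (fun _ _ => true), ih (Nat.div u 4) r m, false)) n

/-- The images of the prefixes of length up to `8` of `u`, framed by `L` and `R`, are
square-free. -/
noncomputable def prefixesCheck (L p R l u : ℕ) : Bool :=
  read one comp high p L 0 0 (prefixes one comp high X R l 8 u)

variable {one comp high X}

theorem digit_zero (c : ℕ) : digit c 0 = c % 4 := by simp [digit]

theorem digit_succ (c t : ℕ) : digit c (t + 1) = digit (c / 4) t := by
  rw [digit, digit, Nat.div_div_eq_div_mul, pow_succ']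

theorem digit_div (c i t : ℕ) : digit (c / 4 ^ i) t = digit c (i + t) := by
  rw [digit, digit, Nat.div_div_eq_div_mul, pow_add]

theorem digit_add_mul {c p d : ℕ} (hc : c < 4 ^ p) :
    digit (c + 4 ^ p * d) = append p (digit c) (digit d) := by
  funext t
  rw [append]
  split_ifs with h
  · obtain ⟨k, rfl⟩ := Nat.exists_eq_add_of_lt h
    rw [digit, digit, show 4 ^ (t + k + 1) * d = 4 ^ t * (4 * (4 ^ k * d)) by ring,
      Nat.add_mul_div_left _ _ (by positivity), Nat.add_mul_mod_self_left]
  · obtain ⟨k, rfl⟩ := Nat.exists_eq_add_of_le (not_lt.1 h)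
    rw [← digit_div, Nat.add_mul_div_left _ _ (by positivity), Nat.div_eq_of_lt hc, Nat.zero_add,
      Nat.add_sub_cancel_left]

theorem ternary_sound {n c : ℕ} (h : ternary n c = true) : (∀ t, digit c t < 3) ∧ c < 4 ^ n := by
  induction n generalizing c with
  | zero =>
    obtain rfl : c = 0 := Nat.eq_of_beq_eq_true h
    simp [digit]
  | succ n ih =>
    change select(Nat.beq (c % 4) 3, false, ternary n (c / 4)) = true at h
    cases hc : Nat.beq (c % 4) 3 with
    | true => rw [hc] at h; exact absurd h Bool.false_ne_true
    | false =>
      rw [hc] at h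
      obtain ⟨h1, h2⟩ := ih h
      have h3 : c % 4 ≠ 3 := Nat.ne_of_beq_eq_false hc
      refine ⟨fun t => ?_, by rw [pow_succ]; omega⟩
      rcases t with _ | t
      · rw [digit_zero]; omega
      · rw [digit_succ]; exact h1 t

theorem select_and {a b : Bool} : select(a, b, false) = true ↔ a = true ∧ b = true := by
  cases a <;> simp

theorem select_imp {a b : Bool} : select(a, b, true) = true ↔ (a = true → b = true) := by
  cases a <;> simp

theorem stateB_push (P : Params 9 200 400 3600 one comp high) {f : ℕ → ℕ} {k r m o : ℕ}
    (h : State 9 200 400 3600 f k r m) (hf : NoSq f k) (hk : k < 400) (ho : o = 3600 * f k)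
    (hc : f k < 3) : State 9 200 400 3600 f (k + 1) runsB(r, m, o) masksB(m, o) :=
  h.push P hf hk ho hc

theorem noSqB_iff (P : Params 9 200 400 3600 one comp high) {f : ℕ → ℕ} {k r m o : ℕ}
    (h : State 9 200 400 3600 f k r m) (hf : NoSq f k) (hk : k < 400) (ho : o = 3600 * f k)
    (hc : f k < 3) : noSqB(runsB(r, m, o)) = true ↔ NoSq f (k + 1) := by
  rw [← (h.push P hf (by omega) ho hc).noSq_iff P hf (by omega)]
  exact ⟨fun h => Nat.eq_of_beq_eq_true h, fun h => congrArg (fun x => Nat.beq x 0) h⟩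

theorem read_sound (P : Params 9 200 400 3600 one comp high) {f : ℕ → ℕ} (h3 : ∀ i, f i < 3)
    {n k c r m : ℕ} {κ : ℕ → ℕ → Bool} (hs : State 9 200 400 3600 f k r m) (hf : NoSq f k)
    (hk : k + n ≤ 400) (hd : ∀ t < n, f (k + t) = digit c t)
    (h : read one comp high n c r m κ = true) :
    NoSq f (k + n) ∧ ∃ r m, State 9 200 400 3600 f (k + n) r m ∧ κ r m = true := by
  induction n generalizing k c r m with
  | zero => exact ⟨hf, r, m, hs, h⟩
  | succ n ih =>
    have ho : 3600 * (c % 4) = 3600 * f k := by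
      rw [← digit_zero, ← hd 0 n.succ_pos, Nat.add_zero]
    obtain ⟨h1, h2⟩ := select_and.1 h
    replace h1 := (noSqB_iff P hs hf (by omega) ho (h3 k)).1 h1
    have := ih (stateB_push P hs hf (by omega) ho (h3 k)) h1 (by omega) (fun t ht => ?_) h2
    · rwa [show k + (n + 1) = k + 1 + n by omega]
    · rw [Nat.add_assoc, Nat.add_comm 1 t, hd (t + 1) (by omega), digit_succ]
      rfl

theorem hasSquare_sound (P : Params 9 200 400 3600 one comp high) {f : ℕ → ℕ} (h3 : ∀ i, f i < 3)
    {n k c r m : ℕ} (hs : State 9 200 400 3600 f k r m) (hk : k + n ≤ 400)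
    (hd : ∀ t < n, f (k + t) = digit c t) (h : hasSquare one comp high n c r m = true) :
    ¬ NoSq f (k + n) := by
  induction n generalizing k c r m with
  | zero => exact absurd h Bool.false_ne_true
  | succ n ih =>
    intro hf
    have hfk : NoSq f k := hf.mono (by omega)
    have ho : 3600 * (c % 4) = 3600 * f k := by
      rw [← digit_zero, ← hd 0 n.succ_pos, Nat.add_zero]
    have h1 := (noSqB_iff P hs hfk (by omega) ho (h3 k)).2 (hf.mono (by omega))
    change select(noSqB(runsB(r, m, 3600 * (c % 4))), _, true) = true at h
    refine ih (stateB_push P hs hfk (by omega) ho (h3 k)) (by omega) (fun t ht => ?_)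
      (select_imp.1 h h1) ?_
    · rw [Nat.add_assoc, Nat.add_comm 1 t, hd (t + 1) (by omega), digit_succ]
      rfl
    · rwa [show k + 1 + n = k + (n + 1) by omega]

theorem ins_lt_three {f : ℕ → ℕ} (h3 : ∀ i, f i < 3) {i a : ℕ} (ha : a < 3) (t : ℕ) :
    ins f i a t < 3 := by
  rw [ins]
  split_ifs
  exacts [h3 _, ha, h3 _]

theorem hasSquare_insertion (P : Params 9 200 400 3600 one comp high) {f : ℕ → ℕ}
    (h3 : ∀ i, f i < 3) {N k a c c' r m : ℕ} (hs : State 9 200 400 3600 f k r m)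
    (hk : k + N < 400) (ha : a < 3) (hd : ∀ t < N, f (k + t) = digit c t) (hc : c' = a + 4 * c)
    (h : hasSquare one comp high (N + 1) c' r m = true) :
    ¬ NoSq (ins f k a) (k + N + 1) := by
  refine hasSquare_sound P (n := N + 1) (k := k) (ins_lt_three h3 ha)
    (hs.congr fun t ht => (ins_of_lt ht).symm) (by omega) (fun t ht => ?_) h
  rcases t with _ | t
  · rw [Nat.add_zero, ins_self, digit_zero]
    omega
  · rw [← Nat.add_assoc, ins_succ (by omega), digit_succ, hd t (by omega)]
    congr 1
    omega

theorem insertions_sound (P : Params 9 200 400 3600 one comp high) {f : ℕ → ℕ}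
    (h3 : ∀ i, f i < 3) {n N k c r m : ℕ} (hs : State 9 200 400 3600 f k r m)
    (hf : NoSq f (k + N)) (hk : k + N < 400) (hn : n ≤ N + 1)
    (hd : ∀ t < N, f (k + t) = digit c t) (h : insertions one comp high n N c r m = true)
    {i a : ℕ} (hi : k ≤ i) (hin : i < k + n) (ha : a < 3) : ¬ NoSq (ins f i a) (k + N + 1) := by
  induction n generalizing k N c r m with
  | zero => omega
  | succ n ih =>
    obtain ⟨h1, h⟩ := select_and.1 h
    obtain ⟨h2, h⟩ := select_and.1 h
    obtain ⟨h4, h⟩ := select_and.1 h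
    rcases hi.eq_or_lt with rfl | hi
    · interval_cases a
      · exact hasSquare_insertion P h3 hs hk ha hd (Nat.zero_add _).symm h1
      · exact hasSquare_insertion P h3 hs hk ha hd rfl h2
      · exact hasSquare_insertion P h3 hs hk ha hd rfl h4
    · obtain ⟨N, rfl⟩ : ∃ M, N = M + 1 := ⟨N - 1, by omega⟩
      have ho : 3600 * (c % 4) = 3600 * f k := by
        rw [← digit_zero, ← hd 0 N.succ_pos, Nat.add_zero]
      have := ih (N := N) (stateB_push P hs (hf.mono (by omega)) (by omega) ho (h3 k))
        (hf.mono (by omega)) (by omega) (by omega) (fun t ht => ?_) h hi (by omega)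
      · rwa [show k + (N + 1) + 1 = k + 1 + N + 1 by omega]
      · rw [Nat.add_assoc, Nat.add_comm 1 t, hd (t + 1) (by omega), digit_succ]
        rfl

theorem insertionsCheck_sound (P : Params 9 200 400 3600 one comp high) {i n N c : ℕ}
    (h3 : ∀ t, digit c t < 3) (hN : N < 400) (hn : i + n ≤ N + 1) (hi : i ≤ N)
    (h : insertionsCheck one comp high i n N c = true) :
    NoSq (digit c) N ∧
      ∀ j, i ≤ j → j < i + n → ∀ a < 3, ¬ NoSq (ins (digit c) j a) (N + 1) := by
  obtain ⟨h1, h2⟩ := select_and.1 h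
  have hsq := (read_sound P h3 .zero noSq_zero (by omega)
    (fun t _ => by rw [Nat.zero_add]) h1).1
  rw [Nat.zero_add] at hsq
  obtain ⟨-, r, m, hs, h⟩ := read_sound P h3 .zero noSq_zero (by omega)
    (fun t _ => by rw [Nat.zero_add]) h2
  rw [Nat.zero_add] at hs
  refine ⟨hsq, fun j hij hj a ha => ?_⟩
  have := insertions_sound P (N := N - i) h3 hs (hsq.mono (by omega)) (by omega) (by omega)
    (fun t _ => (digit_div c i t).symm) h hij hj ha
  rwa [show i + (N - i) + 1 = N + 1 by omega] at this

theorem tree_sound (P : Params 9 200 400 3600 one comp high) {f v : ℕ → ℕ} (h3 : ∀ i, f i < 3)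
    (hv3 : ∀ i, v i < 3) {κ : ℕ → ℕ → Bool} {n k j r m r' m' : ℕ}
    (hs : State 9 200 400 3600 f k r m) (hf : NoSq f k) (hs' : State 9 200 400 3600 v j r' m')
    (hv : NoSq v (j + n)) (hk : k + 32 * n ≤ 400) (hj : j + n ≤ 400)
    (hd : ∀ i < n, ∀ t < 32, f (k + 32 * i + t) = digit (X (v (j + i))) t)
    (h : tree one comp high X κ n r m r' m' = true) :
    NoSq f (k + 32 * n) ∧ ∃ r m, State 9 200 400 3600 f (k + 32 * n) r m ∧ κ r m = true := by
  induction n generalizing k j r m r' m' with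
  | zero => exact ⟨hf, r, m, hs, h⟩
  | succ n ih =>
    have step : ∀ a o, v j = a → o = 3600 * a → (noSqB(runsB(r', m', o)) = true →
        read one comp high 32 (X a) r m (fun r m => tree one comp high X κ n r m
          runsB(r', m', o) masksB(m', o)) = true) → NoSq f (k + 32 * (n + 1)) ∧
        ∃ r m, State 9 200 400 3600 f (k + 32 * (n + 1)) r m ∧ κ r m = true := by
      rintro a o rfl ho h
      have hvj := hv.mono (Nat.le_add_right j (n + 1))
      have hread := h ((noSqB_iff P hs' hvj (by omega) ho (hv3 j)).2 (hv.mono (by omega)))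
      obtain ⟨hf', r, m, hs1, h⟩ := read_sound P h3 hs hf (by omega) (hd 0 n.succ_pos) hread
      rw [show k + 32 * (n + 1) = k + 32 + 32 * n by omega]
      refine ih hs1 hf' (stateB_push P hs' hvj (by omega) ho (hv3 j)) (hv.mono (by omega))
        (by omega) (by omega) (fun i hi t ht => ?_) h
      rw [show k + 32 + 32 * i + t = k + 32 * (i + 1) + t by omega, hd (i + 1) (by omega) t ht,
        show j + (i + 1) = j + 1 + i by omega]
    obtain ⟨h0, h⟩ := select_and.1 h
    obtain ⟨h1, h2⟩ := select_and.1 h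
    have := hv3 j
    rcases (by omega : v j = 0 ∨ v j = 1 ∨ v j = 2) with hj | hj | hj
    · exact step 0 0 hj rfl (select_imp.1 h0)
    · exact step 1 3600 hj rfl (select_imp.1 h1)
    · exact step 2 7200 hj rfl (select_imp.1 h2)

end

section

variable {X u : ℕ → ℕ} {L p R k : ℕ}

theorem append_left {p : ℕ} {f g : ℕ → ℕ} {t : ℕ} (h : t < p) : append p f g t = f t := if_pos h

theorem append_right {p : ℕ} {f g : ℕ → ℕ} (t : ℕ) : append p f g (p + t) = g t := by
  rw [append, if_neg (by omega), Nat.add_sub_cancel_left]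

theorem append_lt_three {p : ℕ} {f g : ℕ → ℕ} (hf : ∀ t, f t < 3) (hg : ∀ t, g t < 3) (t : ℕ) :
    append p f g t < 3 := by
  rw [append]
  split_ifs
  exacts [hf _, hg _]

theorem blocks_apply (i : ℕ) {t : ℕ} (ht : t < 32) :
    blocks X u (32 * i + t) = digit (X (u i)) t := by
  rw [blocks, show (32 * i + t) / 32 = i by omega, show (32 * i + t) % 32 = t by omega]

theorem blocks_lt_three (hX : ∀ x t, digit (X x) t < 3) (t : ℕ) : blocks X u t < 3 := hX _ _

theorem frame_left {t : ℕ} (h : t < p) : frame X L p R u k t = digit L t := append_left h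

theorem frame_block {i t : ℕ} (hi : i < k) (ht : t < 32) :
    frame X L p R u k (p + (32 * i + t)) = digit (X (u i)) t := by
  rw [frame, append_right, append_left (by omega), blocks_apply i ht]

theorem frame_right (t : ℕ) : frame X L p R u k (p + (32 * k + t)) = digit R t := by
  rw [frame, append_right, append_right]

theorem frame_lt_three (hL : ∀ t, digit L t < 3) (hX : ∀ x t, digit (X x) t < 3)
    (hR : ∀ t, digit R t < 3) (t : ℕ) : frame X L p R u k t < 3 :=
  append_lt_three hL (append_lt_three (blocks_lt_three hX) hR) t

variable {one comp high l : ℕ}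

theorem treeCheck_sound (P : Params 9 200 400 3600 one comp high) (hL : ∀ t, digit L t < 3)
    (hX : ∀ x t, digit (X x) t < 3) (hR : ∀ t, digit R t < 3) (hl : p + 288 + l ≤ 400)
    (h : treeCheck one comp high X L p R l = true) (hu : ∀ i, u i < 3) (hs : NoSq u 9) :
    NoSq (frame X L p R u 9) (p + 288 + l) := by
  have h3 : ∀ t, frame X L p R u 9 t < 3 := frame_lt_three hL hX hR
  obtain ⟨hf, r, m, hst, h⟩ := read_sound P h3 .zero noSq_zero (by omega)
    (fun t ht => by rw [Nat.zero_add, frame_left ht]) h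
  rw [Nat.zero_add] at hf hst
  obtain ⟨hf, r, m, hst, h⟩ := tree_sound P (n := 9) (j := 0) h3 hu hst hf .zero
    (by rwa [Nat.zero_add]) (by omega) (by omega)
    (fun i hi t ht => by rw [Nat.add_assoc, frame_block hi ht, Nat.zero_add]) h
  exact (read_sound P h3 hst hf (by omega)
    (fun t _ => by rw [Nat.add_assoc, frame_right]) h).1

theorem prefixes_succ {n c r m : ℕ} : prefixes one comp high X R l (n + 1) c r m =
    read one comp high 32 (X (c % 4)) r m fun r m =>
      select(read one comp high l R r m (fun _ _ => true),
        prefixes one comp high X R l n (c / 4) r m, false) :=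
  rfl

theorem prefixes_sound (P : Params 9 200 400 3600 one comp high) {U n j r m : ℕ}
    (hX : ∀ x t, digit (X x) t < 3) (hL : ∀ t, digit L t < 3) (hR : ∀ t, digit R t < 3)
    (hl : p + 32 * (j + n) + l ≤ 400)
    (hs : State 9 200 400 3600 (append p (digit L) (blocks X (digit U))) (p + 32 * j) r m)
    (hf : NoSq (append p (digit L) (blocks X (digit U))) (p + 32 * j))
    (h : prefixes one comp high X R l n (U / 4 ^ j) r m = true) (hk : j < k) (hkn : k ≤ j + n) :
    NoSq (frame X L p R (digit U) k) (p + 32 * k + l) := by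
  induction n generalizing j r m with
  | zero => omega
  | succ n ih =>
    rw [prefixes_succ] at h
    obtain ⟨hf', r', m', hs', h⟩ := read_sound P
      (append_lt_three hL (blocks_lt_three hX)) hs hf (by omega)
      (fun t ht => by
        rw [Nat.add_assoc, append_right, blocks_apply j ht, ← digit_zero, digit_div,
          Nat.add_zero]) h
    obtain ⟨h1, h2⟩ := select_and.1 h
    have hj : p + 32 * j + 32 = p + 32 * (j + 1) := by ring
    rw [hj] at hf' hs'
    rcases Nat.eq_or_lt_of_le (Nat.succ_le_of_lt hk) with rfl | hk
    · have hc : ∀ t < p + 32 * j.succ, append p (digit L) (blocks X (digit U)) t =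
          frame X L p R (digit U) j.succ t := by
        intro t ht
        rcases Nat.lt_or_ge t p with h | h
        · rw [append_left h, frame_left h]
        · obtain ⟨t, rfl⟩ := Nat.exists_eq_add_of_le h
          rw [frame, append_right, append_right, append_left (by omega)]
      exact (read_sound P (frame_lt_three hL hX hR) (hs'.congr hc) (hf'.congr hc)
        (by omega)
        (fun t _ => by rw [Nat.add_assoc, frame_right]) h1).1
    · refine ih (by omega) hs' hf' ?_ hk (by omega)
      rw [pow_succ, ← Nat.div_div_eq_div_mul]
      exact h2

theorem prefixesCheck_sound (P : Params 9 200 400 3600 one comp high) {U : ℕ}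
    (hL : ∀ t, digit L t < 3) (hX : ∀ x t, digit (X x) t < 3) (hR : ∀ t, digit R t < 3)
    (hl : p + 256 + l ≤ 400) (h : prefixesCheck one comp high X L p R l U = true)
    (hk : 0 < k) (hk8 : k ≤ 8) : NoSq (frame X L p R (digit U) k) (p + 32 * k + l) := by
  obtain ⟨hf, r, m, hs, h⟩ := read_sound P (f := append p (digit L) (blocks X (digit U)))
    (append_lt_three hL (blocks_lt_three hX)) .zero noSq_zero (by omega)
    (fun t ht => by rw [Nat.zero_add, append_left ht]) h
  rw [Nat.zero_add] at hf hs
  refine prefixes_sound P (j := 0) (n := 8) hX hL hR (by omega) hs hf ?_ hk (by omega)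
  rw [pow_zero, Nat.div_one]
  exact h

theorem not_noSq_ins_of_factor {g w : ℕ → ℕ} {d N n i a : ℕ} (hw : ∀ t < N, g (d + t) = w t)
    (hN : d + N ≤ n) (hd : d ≤ i) (hi : i ≤ d + N) (h : ¬ NoSq (ins w (i - d) a) (N + 1)) :
    ¬ NoSq (ins g i a) (n + 1) := by
  refine fun hg => h ((hg.shift d (N + 1) (by omega)).congr fun t ht => ?_)
  obtain ⟨i, rfl⟩ := Nat.exists_eq_add_of_le hd
  rw [Nat.add_sub_cancel_left]
  rcases lt_trichotomy t i with h1 | rfl | h1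
  · rw [ins_of_lt h1, ins_of_lt (by omega), hw t (by omega)]
  · rw [ins_self, ins_self]
  · obtain ⟨t, rfl⟩ : ∃ x, t = x + 1 := ⟨t - 1, by omega⟩
    rw [ins_succ (by omega), ← Nat.add_assoc, ins_succ (by omega), hw t (by omega)]

theorem NoSq.ne_succ {f : ℕ → ℕ} {n i : ℕ} (h : NoSq f n) (hi : i + 1 < n) :
    f i ≠ f (i + 1) := by
  obtain ⟨t, ht, hne⟩ := h i 1 one_pos (by omega)
  obtain rfl : t = 0 := by omega
  exact hne

end

/-! ### Extremal words built from blocks -/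

/-- A substitution whose images of square-free words have good local properties. -/
structure Code (X : ℕ → ℕ) : Prop where
  lt_three : ∀ x t, digit (X x) t < 3
  sync : ∀ x < 3, ∀ b < 3, ∀ c < 3, b ≠ c → ∀ d < 32, 0 < d → ∃ y < 32,
    digit (X x) y ≠ append 32 (digit (X b)) (digit (X c)) (d + y)
  suffix : ∀ a < 3, ∀ b < 3, a ≠ b → ∃ x < 9, digit (X a) (31 - x) ≠ digit (X b) (31 - x)
  prefix_ne : ∀ a < 3, ∀ b < 3, a ≠ b →
    ∃ x < if b = 0 then 6 else 24, digit (X a) x ≠ digit (X b) x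
  ext : ∀ a < 3, ∀ b < 3, a ≠ b → ∀ i, 16 ≤ i → i < 49 → ∀ c < 3,
    ¬ NoSq (ins (append 32 (digit (X a)) (digit (X b))) i c) 65

/-- A word that may precede the image of a square-free word. -/
structure Opening (X : ℕ → ℕ) (L p e : ℕ) : Prop where
  lt_three : ∀ t, digit L t < 3
  hp : 32 ≤ p
  hp' : p ≤ 65
  noSq : ∀ u, (∀ i, u i < 3) → NoSq u 9 → NoSq (append p (digit L) (blocks X u)) (p + 288)
  suffix : ∀ b < 3, ∃ x < (if b = 0 then e else 8) + 1, digit L (p - 1 - x) ≠ digit (X b) (31 - x)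
  ext : ∀ a < 3, ∀ b < 3, a ≠ b → ∀ i < p + 17, ∀ c < 3,
    ¬ NoSq (ins (append p (digit L) (append 32 (digit (X a)) (digit (X b)))) i c) (p + 64 + 1)

/-- A word that may follow the image of a square-free word. -/
structure Ending (X : ℕ → ℕ) (R l e : ℕ) : Prop where
  lt_three : ∀ t, digit R t < 3
  hl : l ≤ 97
  noSq : ∀ u, (∀ i, u i < 3) → NoSq u 9 → NoSq (append 288 (blocks X u) (digit R)) (288 + l)
  sync : ∀ x < 3, ∀ b < 3, ∀ d < l + 1, 0 < d → ∃ y < 32,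
    digit (X x) y ≠ append 32 (digit (X b)) (digit R) (d + y)
  prefix_ne : ∀ b < 3, ∃ x < 32 - (if b = 0 then e else 8), digit R x ≠ digit (X b) x
  ext : ∀ a < 3, ∀ b < 3, a ≠ b → ∀ i, 48 ≤ i → i < l + 65 → ∀ c < 3,
    ¬ NoSq (ins (append 32 (digit (X a)) (append 32 (digit (X b)) (digit R))) i c) (64 + l + 1)

section

variable {X u : ℕ → ℕ} {L p R l e k : ℕ}

theorem frame_sync (hX : Code X) (hR : Ending X R l e) (hu : ∀ i, u i < 3) (hs : NoSq u k)
    {i D : ℕ} (hi : i < k) (hD : 32 * i + D ≤ 32 * k - 32 + l)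
    (h : ∀ y < 32, frame X L p R u k (p + (32 * i + y)) =
      frame X L p R u k (p + (32 * i + y) + D)) :
    ∃ j < k, 32 * i + D = 32 * j ∧ u i = u j := by
  obtain ⟨j, d, hd, hj⟩ : ∃ j d, d < 32 ∧ 32 * i + D = 32 * j + d :=
    ⟨(32 * i + D) / 32, (32 * i + D) % 32, Nat.mod_lt _ (by omega), (Nat.div_add_mod _ _).symm⟩
  have h : ∀ y < 32, digit (X (u i)) y = frame X L p R u k (p + (32 * j + (d + y))) := by
    intro y hy
    rw [← frame_block (L := L) (p := p) (R := R) hi hy, h y hy]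
    congr 1
    omega
  rcases Nat.lt_or_ge (j + 1) k with hjk | hjk
  · rcases Nat.eq_zero_or_pos d with rfl | hd0
    · refine ⟨j, by omega, hj, ?_⟩
      by_contra hne
      obtain ⟨x, hx, hx'⟩ := hX.prefix_ne _ (hu i) _ (hu j) hne
      have hx : x < 32 := hx.trans_le (by split_ifs <;> omega)
      exact hx' (by rw [h x hx, Nat.zero_add, frame_block (by omega) hx])
    · obtain ⟨y, hy, hne⟩ := hX.sync _ (hu i) _ (hu j) _ (hu (j + 1)) (hs.ne_succ hjk) d hd hd0
      refine absurd ?_ hne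
      rw [h y hy]
      rcases Nat.lt_or_ge (d + y) 32 with h1 | h1
      · rw [append_left h1, frame_block (by omega) h1]
      · obtain ⟨z, hz⟩ := Nat.exists_eq_add_of_le h1
        rw [hz, append_right, ← Nat.add_assoc (32 * j), ← Nat.mul_succ,
          frame_block hjk (by omega)]
  · obtain ⟨b, rfl⟩ : ∃ b, k = b + 1 := ⟨k - 1, by omega⟩
    rcases Nat.eq_zero_or_pos (32 * j + d - 32 * b) with h0 | h0
    · obtain rfl : j = b := by omega
      obtain rfl : d = 0 := by omega
      refine ⟨j, by omega, hj, ?_⟩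
      by_contra hne
      obtain ⟨x, hx, hx'⟩ := hX.prefix_ne _ (hu i) _ (hu j) hne
      have hx : x < 32 := hx.trans_le (by split_ifs <;> omega)
      exact hx' (by rw [h x hx, Nat.zero_add, frame_block (by omega) hx])
    · obtain ⟨y, hy, hne⟩ := hR.sync _ (hu i) _ (hu b) (32 * j + d - 32 * b) (by omega) h0
      refine absurd ?_ hne
      rw [h y hy]
      rcases Nat.lt_or_ge (32 * j + d - 32 * b + y) 32 with h1 | h1
      · rw [append_left h1, ← frame_block (L := L) (p := p) (R := R) b.lt_succ_self h1]
        congr 1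
        omega
      · obtain ⟨z, hz⟩ := Nat.exists_eq_add_of_le h1
        rw [hz, append_right, ← frame_right (X := X) (L := L) (p := p) (u := u) (k := b + 1)]
        congr 1
        omega

theorem frame_long (hX : Code X) (hL : Opening X L p e) (hR : Ending X R l e) (he : 8 ≤ e)
    (he' : e ≤ 26) (hu : ∀ i, u i < 3) (hs : NoSq u k) {s q : ℕ} (hq : 129 ≤ q)
    (hn : s + 2 * q ≤ p + 32 * k + l) :
    ∃ t < q, frame X L p R u k (s + t) ≠ frame X L p R u k (s + t + q) := by
  by_contra! h
  have := hL.hp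
  have := hL.hp'
  have := hR.hl
  obtain ⟨i, t, hst, hit⟩ : ∃ i t, s + t = p + 32 * i ∧ (i = 0 ∧ t ≤ p ∨ 0 < i ∧ t < 32) := by
    rcases Nat.lt_or_ge p s with h | h
    · exact ⟨(s - p + 31) / 32, p + 32 * ((s - p + 31) / 32) - s, by omega, by omega⟩
    · exact ⟨0, p - s, by omega, by omega⟩
  have sync : ∀ y, t + 32 * y + 32 ≤ q → ∃ j < k, 32 * (i + y) + q = 32 * j ∧ u (i + y) = u j := by
    intro y hy
    refine frame_sync hX hR hu hs (L := L) (p := p) (by omega) (by omega)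
      fun x hx => ?_
    have := h (t + 32 * y + x) (by omega)
    rwa [show s + (t + 32 * y + x) = p + (32 * (i + y) + x) by omega] at this
  obtain ⟨m, rfl⟩ : ∃ m, q = 32 * m := by
    obtain ⟨j, -, hj, -⟩ := sync 0 (by omega)
    exact ⟨j - i, by omega⟩
  have sync : ∀ y, t + 32 * y + 32 ≤ 32 * m → i + y + m < k ∧ u (i + y) = u (i + y + m) := by
    intro y hy
    obtain ⟨j, hjk, hj, hu⟩ := sync y hy
    obtain rfl : j = i + y + m := by omega
    exact ⟨hjk, hu⟩
  have square : ∀ d, d + 2 * m ≤ k → ¬ ∀ y < m, u (d + y) = u (d + y + m) := by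
    intro d hd hsq
    obtain ⟨y, hy, hne⟩ := hs d m (by omega) hd
    exact hne (hsq y hy)
  rcases Nat.eq_zero_or_pos t with rfl | ht
  · have := (sync (m - 1) (by omega)).1
    exact square i (by omega) fun y hy => (sync y (by omega)).2
  obtain ⟨b, hb⟩ : ∃ b, b + 1 = i + m := ⟨i + m - 1, by omega⟩
  have hbk : b < k := by
    have := (sync 0 (by omega)).1
    omega
  have left : ∀ x < 32, x < t →
      frame X L p R u k (p + 32 * i - 1 - x) = digit (X (u b)) (31 - x) := by
    intro x hx hxt
    have := h (t - 1 - x) (by omega)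
    rwa [show s + (t - 1 - x) = p + 32 * i - 1 - x by omega,
      show p + 32 * i - 1 - x + 32 * m = p + (32 * b + (31 - x)) by omega,
      frame_block hbk (by omega)] at this
  have hte : t ≤ if u b = 0 then e else 8 := by
    by_contra! hte
    rcases hit with ⟨rfl, htp⟩ | ⟨hi, ht32⟩
    · obtain ⟨x, hx, hne⟩ := hL.suffix _ (hu b)
      have hx32 : x < 32 := hx.trans_le (by split_ifs <;> omega)
      refine hne ?_
      rw [← left x hx32 (by omega), Nat.mul_zero, Nat.add_zero, frame_left (by omega)]
    · obtain ⟨i, rfl⟩ : ∃ j, i = j + 1 := ⟨i - 1, by omega⟩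
      have hne : u i ≠ u b := by
        intro hib
        have := (sync (m - 2) (by omega)).1
        refine square i (by omega) fun y hy => ?_
        rcases y with _ | y
        · rw [Nat.add_zero, hib]
          congr 1
          omega
        · rw [show i + (y + 1) = i + 1 + y by omega]
          exact (sync y (by omega)).2
      obtain ⟨x, hx, hne⟩ := hX.suffix _ (hu i) _ (hu b) hne
      have : 8 ≤ if u b = 0 then e else 8 := by split_ifs <;> omega
      refine hne ?_
      rw [← left x (by omega) (by omega), ← frame_block (L := L) (p := p) (R := R) (k := k)
        (by omega) (show 31 - x < 32 by omega)]
      congr 1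
      omega
  have ht32 : t < 32 := hte.trans_lt (by split_ifs <;> omega)
  have hbm : b + m ≤ k := by
    have := (sync (m - 2) (by omega)).1
    omega
  have right : ∀ x < 32 - t, frame X L p R u k (p + (32 * (b + m) + x)) = digit (X (u b)) x := by
    intro x hx
    have := h (t + 32 * (m - 1) + x) (by omega)
    rw [show s + (t + 32 * (m - 1) + x) = p + (32 * b + x) by omega,
      frame_block hbk (by omega)] at this
    rw [this]
    congr 1
    omega
  rcases hbm.lt_or_eq with hbm | hbm
  · have hne : u (b + m) ≠ u b := by
      intro hub
      refine square i (by omega) fun y hy => ?_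
      rcases Nat.lt_or_ge (y + 1) m with h1 | h1
      · exact (sync y (by omega)).2
      · rw [show i + y = b by omega, hub]
    obtain ⟨x, hx, hne⟩ := hX.prefix_ne _ (hu _) _ (hu b) hne
    have hx : x < 32 - t := by split_ifs at hx hte <;> omega
    exact hne (by rw [← right x hx, frame_block hbm (by omega)])
  · obtain ⟨x, hx, hne⟩ := hR.prefix_ne _ (hu b)
    exact hne (by rw [← right x (by omega), hbm, frame_right])

theorem frame_noSq (hX : Code X) (hL : Opening X L p e) (hR : Ending X R l e) (he : 8 ≤ e)
    (he' : e ≤ 26) (hu : ∀ i, u i < 3) (hs : NoSq u k) (hk : 9 ≤ k) :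
    NoSq (frame X L p R u k) (p + 32 * k + l) := by
  intro s q hq hn
  rcases Nat.lt_or_ge 128 q with h | h
  · exact frame_long hX hL hR he he' hu hs h hn
  have window : ∀ d, d + 9 ≤ k → NoSq (fun i => u (d + i)) 9 := fun d hd => hs.shift d 9 hd
  have block : ∀ d, d + 9 ≤ k → ∀ t < 288,
      frame X L p R u k (p + (32 * d + t)) = blocks X (fun i => u (d + i)) t := by
    intro d hd t ht
    rw [← Nat.div_add_mod t 32, blocks_apply _ (Nat.mod_lt _ (by omega)), ← Nat.add_assoc (32 * d),
      ← Nat.mul_add, frame_block (by omega) (Nat.mod_lt _ (by omega))]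
  rcases Nat.lt_or_ge (p + 288) (s + 2 * q) with h1 | h1
  · obtain ⟨i, x, hx, hs'⟩ : ∃ i x, x < 32 ∧ s = p + (32 * i + x) :=
      ⟨(s - p) / 32, (s - p) % 32, Nat.mod_lt _ (by omega), by omega⟩
    rcases Nat.lt_or_ge k (i + 9) with hik | hik
    · obtain ⟨d, rfl⟩ := Nat.exists_eq_add_of_le' hk
      have key : ∀ t, frame X L p R u (d + 9) (p + (32 * d + t)) =
          append 288 (blocks X fun i => u (d + i)) (digit R) t := by
        intro t
        rcases Nat.lt_or_ge t 288 with ht | ht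
        · rw [block d le_rfl t ht, append_left ht]
        · obtain ⟨t, rfl⟩ := Nat.exists_eq_add_of_le ht
          rw [append_right, ← frame_right (X := X) (L := L) (p := p) (u := u) (k := d + 9)]
          congr 1
          omega
      obtain ⟨t, ht, hne⟩ := hR.noSq _ (fun i => hu (d + i)) (window d le_rfl)
        (32 * (i - d) + x) q hq (by omega)
      refine ⟨t, ht, fun heq => hne ?_⟩
      rw [← key, ← key]
      convert heq using 2 <;> omega
    · obtain ⟨t, ht, hne⟩ := hL.noSq _ (fun y => hu (i + y)) (window i hik) (p + x) q hq (by omega)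
      refine ⟨t, ht, fun heq => hne ?_⟩
      rw [Nat.add_assoc p, append_right, Nat.add_assoc p, append_right, ← block i hik _ (by omega),
        ← block i hik _ (by omega)]
      convert heq using 2 <;> omega
  · have key : ∀ t < p + 288, frame X L p R u k t = append p (digit L) (blocks X u) t := by
      intro t ht
      rcases Nat.lt_or_ge t p with h | h
      · rw [frame_left h, append_left h]
      · obtain ⟨t, rfl⟩ := Nat.exists_eq_add_of_le h
        have := block 0 (by omega) t (by omega)
        rw [Nat.mul_zero, Nat.zero_add] at this
        rw [append_right, this]
        congr 1
        funext i
        rw [Nat.zero_add]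
    obtain ⟨t, ht, hne⟩ := hL.noSq u hu (hs.mono hk) s q hq h1
    exact ⟨t, ht, by rwa [key _ (by omega), key _ (by omega)]⟩

theorem frame_extremal (hX : Code X) (hL : Opening X L p e) (hR : Ending X R l e)
    (hu : ∀ i, u i < 3) (hs : NoSq u k) (hk : 2 ≤ k)
    (h : NoSq (frame X L p R u k) (p + 32 * k + l)) :
    Extremal (frame X L p R u k) (p + 32 * k + l) where
  lt_three := frame_lt_three hL.lt_three hX.lt_three hR.lt_three
  noSq := h
  ext i hi a ha := by
    have two : ∀ d, d + 1 < k → ∀ t < 64, frame X L p R u k (p + (32 * d + t)) =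
        append 32 (digit (X (u d))) (digit (X (u (d + 1)))) t := by
      intro d hd t ht
      rcases Nat.lt_or_ge t 32 with h | h
      · rw [append_left h, frame_block (by omega) h]
      · obtain ⟨t, rfl⟩ := Nat.exists_eq_add_of_le h
        rw [append_right, ← Nat.add_assoc (32 * d), ← Nat.mul_succ, frame_block hd (by omega)]
    rcases Nat.lt_or_ge i (p + 17) with h1 | h1
    · refine not_noSq_ins_of_factor (d := 0) (N := p + 64) (fun t ht => ?_) (by omega) (by omega)
        (by omega) (hL.ext _ (hu 0) _ (hu 1) (hs.ne_succ (by omega)) i h1 a ha)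
      rw [Nat.zero_add]
      rcases Nat.lt_or_ge t p with h | h
      · rw [append_left h, frame_left h]
      · obtain ⟨t, rfl⟩ := Nat.exists_eq_add_of_le h
        rw [append_right, ← two 0 (by omega) t (by omega), Nat.mul_zero, Nat.zero_add]
    rcases Nat.lt_or_ge i (p + 32 * (k - 2) + 48) with h2 | h2
    · obtain ⟨d, x, hx, hi'⟩ : ∃ d x, x < 32 ∧ i = p + 16 + (32 * d + x) :=
        ⟨(i - p - 16) / 32, (i - p - 16) % 32, Nat.mod_lt _ (by omega), by omega⟩
      refine not_noSq_ins_of_factor (d := p + 32 * d) (N := 64) (fun t ht => ?_) (by omega)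
        (by omega) (by omega) (hX.ext _ (hu d) _ (hu (d + 1)) (hs.ne_succ (by omega))
          (i - (p + 32 * d)) (by omega) (by omega) a ha)
      rw [Nat.add_assoc, two d (by omega) t ht]
    · obtain ⟨d, rfl⟩ := Nat.exists_eq_add_of_le' hk
      refine not_noSq_ins_of_factor (d := p + 32 * d) (N := 64 + l) (fun t ht => ?_) (by omega)
        (by omega) (by omega) (hR.ext _ (hu d) _ (hu (d + 1)) (hs.ne_succ (by omega))
          (i - (p + 32 * d)) (by omega) (by omega) a ha)
      rw [Nat.add_assoc]
      rcases Nat.lt_or_ge t 32 with h | h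
      · rw [append_left h, frame_block (by omega) h]
      obtain ⟨t, rfl⟩ := Nat.exists_eq_add_of_le h
      rw [append_right]
      rcases Nat.lt_or_ge t 32 with h | h
      · rw [append_left h, ← Nat.add_assoc (32 * d), ← Nat.mul_succ, frame_block (by omega) h]
      obtain ⟨t, rfl⟩ := Nat.exists_eq_add_of_le h
      rw [append_right, ← frame_right (X := X) (L := L) (p := p) (u := u) (k := d + 2)]
      congr 1
      omega

end

/-! ### The words -/

local notation "oneB" => 139820643007299820666149911003962150027215873676103766476894945183826992734487042399537146673534677177286650385725904936764191764959725614082364818273906117930574556067265596822187693390380520772237348149479408303671611659134827841532413738013409068472850893864010054657367489638695524688996583645114331266900639192092211679498285049197583399157675952723416756522482811870435714433061947656605200280163534330380617435044760915798854671006617410351187460732191936340727322527908759610700696015679721523397829822997932092532787809354114138625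
local notation "compB" => 7830229630019371757344837579648502636651343751446304276456560951713458025602379045689930579954093653194544176298078711497809932950787608411340575351358848095536696812087944391899305717715302080115687264175444672066869884245521268769340673073835082803302493208818739205733631019550978140949149186247038782514472782309398868164779693254182473842847774440481442899029140170834166027262101283931645824691663134897264440584493000249346035460266869729980296602295766423214469253974882531857968332447566713962966137073839183350314655069054176722175
local notation "highB" => 35794084609868754090534377217014310406967263661082564218085105967059710140028682854281509548424877357385382498745831663811633091829689757205085393478119966190227086353219992786480049507937413317692761126266728525739932584738515927432297916931432721529049828829186573992286077347506054320383125413149268804326563633175606189951560972594581350184365043897194689669755599838831542894863858600090931271721864788577438063371458794444506795777694057049903989947441135703226194567144642460339378180014008709989844434687470615688393679194653219488000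

/-- The images of the three letters under a square-free substitution. -/
def code (a : ℕ) : ℕ :=
  if a = 0 then 10486950119887627396 else if a = 1 then 10981049289506591108 else 10981009962638545284

/-- Words that may precede the image of a square-free word under `code`, with their lengths and a
bound for the length of their common suffix with the image of `0`. -/
def openings : List (ℕ × ℕ × ℕ) :=
  [(175941827342580610960220744, 44, 26),
    (737953507384200225328059148439940, 55, 13),
    (11807380842651537411197160930247825, 57, 13),
    (773800337095068507413704075743366579345, 65, 13)]

/-- Words that may follow the image of a square-free word under `code`, with their lengths and
a bound for the length of the opening that may be combined with them. -/
def endings : List (ℕ × ℕ × ℕ) :=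
  [(5930258028224095174993583726432644, 58, 26),
    (8357093562776667784133145189236707716, 62, 26),
    (729114132131623540321882261842032103812, 65, 26),
    (191132895053512321354139503648315206228545924, 74, 26),
    (178006379914947153398897036583265412, 59, 13),
    (23844202054706933187273236973241562075524, 68, 26),
    (1526028931501243723985487166287459352077444, 71, 13),
    (48295158004050194852862998488196, 53, 13),
    (1554581560550777205553518012275710071172, 67, 26),
    (24290336883605893836773718941807961220, 64, 13),
    (99493219875249741155425152785524274532740, 70, 26),
    (1591891518003995858486802444679591078683780, 72, 13)]

/-- The square-free word `010201202`. -/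
def seed : ℕ := 140420

/-- The lengths and codes of some extremal words. -/
def words : List (ℕ × ℕ) :=
  [(25, 643783680221476),
    (41, 1843058175260143079952772),
    (48, 10389967182607586474250881412),
    (50, 166233992238338389646799030660),
    (63, 32423422443848960163972302020955115908),
    (71, 2985686036077805047330869833799580647985540),
    (72, 2924419318361404808169569772191485305309572),
    (77, 1639652043868843928414280894003104162738495780),
    (79, 217502055590839685624100668929657859840654074148),
    (81, 3477624996967963551516460047297693761470813718916),
    (83, 13345175839819919447631333377781313068076845130020),
    (84, 102410068024182280904331558827000491884275364827524),
    (85, 570398877471659243977160917433503105649865421001092),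
    (87, 14254216923673495117158332960431895495277911760593188),
    (88, 26243278021635867421822230898480836372733199639923076),
    (89, 104867909656762655645486690525312230768869127387236740),
    (90, 803016332950983012008906252171618845764925124778543492),
    (91, 437575808550845274209296675040620560977959514833195396),
    (92, 14596315868366100058985181589440304371063917319665377572),
    (93, 26846180762210012046726660964283697638169986045884653860),
    (94, 51446928720513753918214661816009727151651671389941287300),
    (95, 840611362247306844312649320848585780770779653191205669252),
    (96, 1719879468425928207356541724162850805507889719476715938084),
    (97, 13449781795956909509002389133633787868346232676681795539332),
    (98, 59786509796827545841603303790839568718066827425968863875460),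
    (99, 239146039187310184137783981513534096782772809550117731459364),
    (100, 631444136560995283403487320210339907210487178355995311235364),
    (101, 1759391571779992934497949632068408002967437622190346444771716),
    (102, 3368094619927253151515308334802682062717851515852046412059012),
    (103, 55090306236239501348873785891132917739306799798286729457328420),
    (104, 161649698959614792551292753973852812044411334435911049200308612),
    (105, 234770816169557559529189218253142356886648347807620027238617476),
    (106, 2586395183353836680820684063581552216045268853293026151326048840),
    (107, 1879371359854680487187071304503637094502936401343676707259048520),
    (108, 62690699296718240708405025875267371447461234251061393646083936644),
    (109, 225649894343636997524987027010080431016311765344529313213723206216),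
    (110, 120973950140605110435236516475238973306907528640940461896361075272),
    (111, 481119689535139227106580858453134715951858774982603868840837538376),
    (112, 7379423107083111485136488133583051960478327198895086600430796694088),
    (113, 30791620345286370085761900619004716175741806423453417760994669138308),
    (114, 61543760833952496885219778468138195030186541118597414396033067534434),
    (115, 123166640520995642139284699772420408767863415088939322043628111103121),
    (116, 3697047868926148567449387450548486345009810922752686939447172658726033),
    (117, 10848127663121730605712918450616358785967535329636257757066613394805124),
    (118, 59152765902818377079190199208529763920054672092755966622666735101436488),
    (119, 31530659973374884387656883139584625527308947158137705888928190751609220),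
    (120, 946444254445094033267043187336488392133440502628814581528027260165591428),
    (121, 504490559573998150202510130233354008436943279254707628028799266580956305),
    (122, 15139226786727731131282068951365543890679138144471960552171331174012588420),
    (123, 30951543855731122834553912724639929170042089683631651213531747458641072516),
    (124, 32287395812735881612960648334934668026491921202193772213694834806580937873),
    (125, 129149583250943526451842593339581384424428510361511221437277705818902925700),
    (126, 2841768346124850123052671291104108708958201218208402351989948367673239310724),
    (127, 15506542664828420641047235581385320188175761538528351022548672470774732853636),
    (128, 31694380908268669782583206630031274577522730347202313752288768074192582706321),
    (129, 248104682637254730256755769301133222928940991377334719023222576158056908362116),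
    (130, 992418730549018921027023077204545652269714508484648052012272821481504005260433),
    (131, 3969674922196075684108092308818131566863055862037480228875895024477125089002641),
    (132, 15874501659907957997451579868847849235386419374895271549563854639737730937152072),
    (133, 32455046050067117857365203589152038369406054232103878476252205732318130062591121),
    (134, 33855788351735339798191824790766355251821216203403539869424049437964849394246216),
    (135, 135423153406941359192767299153644889754229549680832126703186847765888063026857105),
    (136, 2077122947204295542871373029705729610712529656026077025127348337997222118886573201),
    (137, 2166770454511061747084276786609679489085543862060957668491139644916913572156114065),
    (138, 47710570020803315935702277642354946077165732128220181937702875310139114341871673928),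
    (139, 260156615701042016033707937550705070365937228974480130470668007957619806851522200721),
    (140, 1156439285728444762132914223539326433808506049280789020657045368176753563946536440196),
    (141, 4162505851216672256539327000811334647497625558093325690564519256630879142639818793544),
    (142, 18503028571655116194126627576629222940936096788492624330637450395161862971359138251921),
    (143, 8875091781677308916057197717344080222105578408712730967816356199160365970067898524232),
    (144, 136126329467980712697618302874794751140953443806228358335875766824284583161406152794696),
    (145, 142001468506836942656915163487210486256757342852497224343531086032610476919678750462340),
    (146, 568005874027347770627660653909329375675724170060811044787100643644255087273158826549832),
    (147, 2272023496109391082510642615795367780108117485639955589496622101026101436663074562606225),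
    (148, 68198495866333958251140333581575668947675661405796340848853313640625354369557476730832017),
    (149, 200112634680535431242379805924439919750599161536768118925489967042596484597815723712614788),
    (150, 1091175933861343332018245337300672479456131983389494207286072125683988986077534332536513096),
    (151, 581638015004004117122724509603861434513026245292667152494459158985956012009768086624833924),
    (152, 17458814941781493312291925396810984157337880868813068317237525376161116816489217686477771140),
    (153, 9306208240064065873963592153661782952208419924682674439911346668499800525962237600552551569),
    (154, 37224832960256263495854368614647145051898315941977442349236014071560313534718122213221372292),
    (155, 570955208192869375190471238220963123889504951792847273978540527340481903048975718285674320260),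
    (156, 595597327364100215933669897834354320830373055071639077587776225269689520889295903626097165457),
    (157, 2382389309456400863734679591334515837714191948005348454091658833085991468326916404827536265604),
    (158, 36541133324343640012190159246141625064772101270111926000454068616634039372408606507085713674628),
    (159, 38118228951302413819754873464015028726433382361135667741554809608794493169081693109594344690052),
    (160, 584658133189498240195042547938266001036353620321790816007265097866269354462871510061585974002833),
    (161, 4576723584098367782857454491221559783272772201817111720042498404499904058039703318341221294313860),
    (162, 18306894336393471131429817964886474523764725769896531923815655408833655400338938033942224158950545),
    (163, 73227577345573884525719271859544956532364355229073787520679974471998589653139586899407755264230545),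
    (164, 39033066446133671751428990424472244769939328537174938588792502691100563498352529826976922480510097),
    (165, 598689928386046197959723569088784628595561544331136623159322111996573288144854702886245344849003665),
    (167, 2498116252552554992091455387163181279046996536071656260597615252561976726065736636217564776050033809),
    (168, 38316155416706956669422308421682200643918470861408882917852125453755654605136098916883035410894783633),
    (169, 39969860040840879873463286197403022761848610342710193937768576040351294605436377374195125686524019857),
    (171, 4799042508919530096277538200587138271305030384292579738955282806996891397699213318673073586015258117265)]

theorem paramsB : Params 9 200 400 3600 oneB compB highB where
  hK := rfl
  hQJ := by decide
  hB := by decide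
  hQ := by decide
  hone := by decide +kernel
  hC := by decide +kernel
  hH := by decide +kernel

theorem code_ternary : ∀ a < 3, ternary 32 (code a) = true := by decide +kernel

theorem code_lt_three (x t : ℕ) : digit (code x) t < 3 := by
  have h := fun a ha => (ternary_sound (code_ternary a ha)).1 t
  rcases x with _ | _ | x
  exacts [h 0 (by omega), h 1 (by omega), h 2 (by omega)]

theorem digit_code_add_mul {a : ℕ} (ha : a < 3) (d : ℕ) :
    digit (code a + 4 ^ 32 * d) = append 32 (digit (code a)) (digit d) :=
  digit_add_mul (ternary_sound (code_ternary a ha)).2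

theorem code_insertionsCheck : ∀ a < 3, ∀ b < 3, a ≠ b →
    insertionsCheck oneB compB highB 16 33 64 (code a + 4 ^ 32 * code b) = true := by
  decide +kernel

set_option synthInstance.maxSize 1000 in
theorem code_sync : ∀ x < 3, ∀ b < 3, ∀ c < 3, b ≠ c → ∀ d < 32, 0 < d → ∃ y < 32,
    digit (code x) y ≠ append 32 (digit (code b)) (digit (code c)) (d + y) := by
  decide +kernel

theorem code_spec : Code code where
  lt_three := code_lt_three
  sync := code_sync
  suffix := by decide +kernel
  prefix_ne := by decide +kernel
  ext a ha b hb hab i hi hi' c hc := by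
    have h := code_insertionsCheck a ha b hb hab
    rw [← digit_code_add_mul ha]
    refine (insertionsCheck_sound paramsB ?_ (by omega) (by omega) (by omega) h).2 i hi hi' c hc
    rw [digit_code_add_mul ha]
    exact append_lt_three (code_lt_three _) (code_lt_three _)

theorem openings_bounds : ∀ w ∈ openings, ternary w.2.1 w.1 = true ∧ 32 ≤ w.2.1 ∧ w.2.1 ≤ 65 ∧
    8 ≤ w.2.2 ∧ w.2.2 ≤ 26 := by
  decide +kernel

theorem openings_suffix : ∀ w ∈ openings, ∀ b < 3, ∃ x < (if b = 0 then w.2.2 else 8) + 1,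
    digit w.1 (w.2.1 - 1 - x) ≠ digit (code b) (31 - x) := by
  decide +kernel

theorem openings_treeCheck : ∀ w ∈ openings,
    treeCheck oneB compB highB code w.1 w.2.1 0 0 = true := by
  decide +kernel

theorem openings_insertionsCheck : ∀ w ∈ openings, ∀ a < 3, ∀ b < 3, a ≠ b →
    insertionsCheck oneB compB highB 0 (w.2.1 + 17) (w.2.1 + 64)
      (w.1 + 4 ^ w.2.1 * (code a + 4 ^ 32 * code b)) = true := by
  decide +kernel

theorem digit_zero_left (t : ℕ) : digit 0 t = 0 := by simp [digit]

theorem opening_spec {w : ℕ × ℕ × ℕ} (hw : w ∈ openings) : Opening code w.1 w.2.1 w.2.2 where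
  lt_three := (ternary_sound (openings_bounds w hw).1).1
  hp := (openings_bounds w hw).2.1
  hp' := (openings_bounds w hw).2.2.1
  noSq u hu hs := by
    have hb := openings_bounds w hw
    refine (treeCheck_sound paramsB (ternary_sound hb.1).1 code_lt_three
      (fun t => by rw [digit_zero_left]; omega) (by omega) (openings_treeCheck w hw) hu hs).congr
      fun t ht => ?_
    rcases Nat.lt_or_ge t w.2.1 with h | h
    · rw [append_left h, frame_left h]
    · obtain ⟨t, rfl⟩ := Nat.exists_eq_add_of_le h
      rw [frame, append_right, append_right, append_left (by omega)]
  suffix := openings_suffix w hw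
  ext a ha b hb hab i hi c hc := by
    have h := openings_insertionsCheck w hw a ha b hb hab
    have hb := openings_bounds w hw
    obtain ⟨h1, h2⟩ := ternary_sound hb.1
    rw [← digit_code_add_mul ha, ← digit_add_mul h2]
    refine (insertionsCheck_sound paramsB ?_ (by omega) (by omega) (by omega) h).2 i (by omega)
      (by omega) c hc
    rw [digit_add_mul h2, digit_code_add_mul ha]
    exact append_lt_three h1 (append_lt_three (code_lt_three _) (code_lt_three _))

theorem endings_bounds : ∀ w ∈ endings, ternary w.2.1 w.1 = true ∧ w.2.1 ≤ 74 := by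
  decide +kernel

theorem endings_sync : ∀ w ∈ endings, ∀ x < 3, ∀ b < 3, ∀ d < w.2.1 + 1, 0 < d → ∃ y < 32,
    digit (code x) y ≠ append 32 (digit (code b)) (digit w.1) (d + y) := by
  decide +kernel

theorem endings_prefix_ne : ∀ w ∈ endings, ∀ b < 3, ∃ x < 32 - (if b = 0 then w.2.2 else 8),
    digit w.1 x ≠ digit (code b) x := by
  decide +kernel

theorem endings_treeCheck : ∀ w ∈ endings,
    treeCheck oneB compB highB code 0 0 w.1 w.2.1 = true := by
  decide +kernel

theorem endings_insertionsCheck : ∀ w ∈ endings, ∀ a < 3, ∀ b < 3, a ≠ b →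
    insertionsCheck oneB compB highB 48 (w.2.1 + 17) (64 + w.2.1)
      (code a + 4 ^ 32 * (code b + 4 ^ 32 * w.1)) = true := by
  decide +kernel

theorem ending_spec {w : ℕ × ℕ × ℕ} (hw : w ∈ endings) : Ending code w.1 w.2.1 w.2.2 where
  lt_three := (ternary_sound (endings_bounds w hw).1).1
  hl := (endings_bounds w hw).2.trans (by omega)
  noSq u hu hs := by
    have hb := endings_bounds w hw
    have := treeCheck_sound paramsB (fun t => by rw [digit_zero_left]; omega) code_lt_three
      (ternary_sound hb.1).1 (by omega) (endings_treeCheck w hw) hu hs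
    rw [Nat.zero_add] at this
    exact this.congr fun t _ => by
      rw [frame, ← Nat.zero_add t, append_right, Nat.zero_add]
  sync := endings_sync w hw
  prefix_ne := endings_prefix_ne w hw
  ext a ha b hb hab i hi hi' c hc := by
    have h := endings_insertionsCheck w hw a ha b hb hab
    have hl := (endings_bounds w hw).2
    rw [← digit_code_add_mul hb, ← digit_code_add_mul ha]
    refine (insertionsCheck_sound paramsB ?_ (by omega) (by omega) (by omega) h).2 i (by omega)
      (by omega) c hc
    rw [digit_code_add_mul ha, digit_code_add_mul hb]
    exact append_lt_three (code_lt_three _) (append_lt_three (code_lt_three _)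
      (ternary_sound (endings_bounds w hw).1).1)

theorem Ending.mono {X : ℕ → ℕ} {R l e e' : ℕ} (h : Ending X R l e) (he : e' ≤ e) :
    Ending X R l e' where
  lt_three := h.lt_three
  hl := h.hl
  noSq := h.noSq
  sync := h.sync
  prefix_ne b hb := by
    obtain ⟨x, hx, hne⟩ := h.prefix_ne b hb
    exact ⟨x, by split_ifs at hx ⊢ <;> omega, hne⟩
  ext := h.ext

theorem words_check : ∀ w ∈ words, ternary w.1 w.2 = true ∧ w.1 < 400 ∧
    insertionsCheck oneB compB highB 0 (w.1 + 1) w.1 w.2 = true := by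
  decide +kernel

theorem words_extremal {w : ℕ × ℕ} (hw : w ∈ words) : Extremal (digit w.2) w.1 := by
  obtain ⟨h1, h2, h⟩ := words_check w hw
  have h3 := (ternary_sound h1).1
  obtain ⟨hs, h⟩ := insertionsCheck_sound paramsB h3 h2 (by omega) (by omega) h
  exact ⟨h3, hs, fun i hi a ha => h i (by omega) (by omega) a ha⟩

/-- Every residue class is covered by the words that consist of an opening, at least two blocks and
an ending, up to words from the table. -/
theorem residues : ∀ r < 32, ∃ w ∈ openings, ∃ v ∈ endings, w.2.2 ≤ v.2.2 ∧
    (w.2.1 + v.2.1) % 32 = r ∧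
    prefixesCheck oneB compB highB code w.1 w.2.1 v.1 v.2.1 seed = true ∧
    ∀ n < w.2.1 + v.2.1 + 64, n % 32 = r → 87 ≤ n → ∃ x ∈ words, x.1 = n := by
  decide +kernel

theorem seed_read : read oneB compB highB 9 seed 0 0 (fun _ _ => true) = true ∧
    ternary 9 seed = true := by
  decide +kernel

theorem seed_lt_three (t : ℕ) : digit seed t < 3 := (ternary_sound seed_read.2).1 t

theorem noSq_seed : NoSq (digit seed) 9 := by
  have := (read_sound paramsB seed_lt_three .zero noSq_zero (by omega)
    (fun t _ => by rw [Nat.zero_add]) seed_read.1).1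
  rwa [Nat.zero_add] at this

theorem exists_noSq (k : ℕ) : ∃ u : ℕ → ℕ, (∀ i, u i < 3) ∧ NoSq u k := by
  induction k with
  | zero => exact ⟨_, seed_lt_three, noSq_zero⟩
  | succ k ih =>
    rcases Nat.lt_or_ge k 9 with hk | hk
    · exact ⟨_, seed_lt_three, noSq_seed.mono hk⟩
    · obtain ⟨u, hu, hs⟩ := ih
      obtain ⟨w, hw, v, hv, he, -⟩ := residues 0 (by omega)
      have hL := opening_spec hw
      have hR := (ending_spec hv).mono he
      have hb := openings_bounds w hw
      exact ⟨_, frame_lt_three hL.lt_three code_lt_three hR.lt_three,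
        (frame_noSq code_spec hL hR hb.2.2.2.1 hb.2.2.2.2 hu hs hk).mono (by omega)⟩

theorem exists_extremal {n : ℕ} (hn : 87 ≤ n) : ∃ f, Extremal f n := by
  obtain ⟨w, hw, v, hv, he, hr, hU, h⟩ := residues (n % 32) (Nat.mod_lt _ (by omega))
  rcases Nat.lt_or_ge n (w.2.1 + v.2.1 + 64) with hlt | hge
  · obtain ⟨x, hx, rfl⟩ := h n hlt rfl hn
    exact ⟨_, words_extremal hx⟩
  obtain ⟨k, hk, rfl⟩ : ∃ k, 2 ≤ k ∧ n = w.2.1 + 32 * k + v.2.1 :=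
    ⟨(n - w.2.1 - v.2.1) / 32, by omega, by omega⟩
  have hL := opening_spec hw
  have hR := (ending_spec hv).mono he
  have hb := openings_bounds w hw
  obtain ⟨u, hu, hs, hf⟩ : ∃ u, (∀ i, u i < 3) ∧ NoSq u k ∧
      NoSq (frame code w.1 w.2.1 v.1 u k) (w.2.1 + 32 * k + v.2.1) := by
    rcases Nat.lt_or_ge k 9 with hk9 | hk9
    · exact ⟨_, seed_lt_three, noSq_seed.mono (by omega),
        prefixesCheck_sound paramsB hL.lt_three code_lt_three hR.lt_three
          (by have := (endings_bounds v hv).2; omega) hU (by omega) (by omega)⟩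
    · obtain ⟨u, hu, hs⟩ := exists_noSq k
      exact ⟨u, hu, hs, frame_noSq code_spec hL hR hb.2.2.2.1 hb.2.2.2.2 hu hs hk9⟩
  exact ⟨_, frame_extremal code_spec hL hR hu hs hk hf⟩

/-! ### Lists and letter functions -/

theorem noSq_comp {f σ : ℕ → ℕ} (h3 : ∀ i, f i < 3)
    (hσ : ∀ x < 3, ∀ y < 3, σ x = σ y → x = y) {n : ℕ} : NoSq (σ ∘ f) n ↔ NoSq f n := by
  have : ∀ i j, (σ ∘ f) i ≠ (σ ∘ f) j ↔ f i ≠ f j := fun i j =>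
    not_congr ⟨hσ _ (h3 i) _ (h3 j), congrArg σ⟩
  simp only [NoSq, this]

theorem comp_ins (σ f : ℕ → ℕ) (i a : ℕ) : σ ∘ ins f i a = ins (σ ∘ f) i (σ a) := by
  funext t
  simp only [ins, Function.comp_apply]
  split_ifs <;> rfl

theorem Extremal.comp {f : ℕ → ℕ} {n : ℕ} (E : Extremal f n) {σ : ℕ → ℕ}
    (hσ : ∀ x < 3, ∀ y < 3, σ x = σ y → x = y) (h3 : ∀ x < 3, σ x < 3)
    (hsurj : ∀ y < 3, ∃ x < 3, σ x = y) : Extremal (σ ∘ f) n where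
  lt_three i := h3 _ (E.lt_three i)
  noSq := (noSq_comp E.lt_three hσ).2 E.noSq
  ext i hi a ha := by
    obtain ⟨x, hx, rfl⟩ := hsurj a ha
    rw [← comp_ins, noSq_comp (ins_lt_three E.lt_three hx) hσ]
    exact E.ext i hi x hx

theorem Extremal.two_le {f : ℕ → ℕ} {n : ℕ} (E : Extremal f n) : 2 ≤ n := by
  by_contra! hn
  have h := E.lt_three 0
  refine E.ext 0 (by omega) ((f 0 + 1) % 3) (Nat.mod_lt _ (by omega)) fun s q hq hs => ?_
  obtain rfl : s = 0 := by omega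
  obtain rfl : q = 1 := by omega
  refine ⟨0, one_pos, ?_⟩
  rw [Nat.add_zero, ins_self, ins_succ le_rfl]
  omega

theorem Extremal.okLength {f : ℕ → ℕ} {n : ℕ} (E : Extremal f n) (hn : n ≤ 86) :
    okLength n = true := by
  have h2 := E.two_le
  have hne : f 0 ≠ f 1 := E.noSq.ne_succ h2
  have h0 := E.lt_three 0
  have h1 := E.lt_three 1
  refine (E.comp (σ := fun x => if x = f 0 then 0 else if x = f 1 then 1 else 2) ?_ ?_ ?_
    ).okLength_of_start_zero_one hn h2 ?_ ?_
  · intro x hx y hy h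
    split_ifs at h <;> omega
  · intro x _
    split_ifs <;> omega
  · intro y hy
    interval_cases y
    · exact ⟨f 0, h0, if_pos rfl⟩
    · exact ⟨f 1, h1, by simp [hne.symm]⟩
    · refine ⟨3 - f 0 - f 1, by omega, ?_⟩
      split_ifs <;> omega
  · simp
  · simp [hne.symm]

theorem mem_of_okLength : ∀ n < 87, okLength n = true →
    n ∈ [25, 41, 48, 50, 63, 71, 72, 77, 79, 81, 83, 84, 85] := by
  decide +kernel

theorem exists_words : ∀ n ∈ [25, 41, 48, 50, 63, 71, 72, 77, 79, 81, 83, 84, 85],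
    ∃ w ∈ words, w.1 = n := by
  decide +kernel

/-- The letters of a word as a function on natural numbers. -/
def letters (w : List (Fin 3)) (i : ℕ) : ℕ := (w.getD i 0).val

theorem letters_lt_three (w : List (Fin 3)) (i : ℕ) : letters w i < 3 := (w.getD i 0).isLt

theorem letters_append_left {v w : List (Fin 3)} {i : ℕ} (h : i < v.length) :
    letters (v ++ w) i = letters v i := by
  rw [letters, List.getD_append _ _ _ _ h, letters]

theorem letters_append_right (v w : List (Fin 3)) (i : ℕ) :
    letters (v ++ w) (v.length + i) = letters w i := by
  rw [letters, List.getD_append_right _ _ _ _ (by omega), Nat.add_sub_cancel_left, letters]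

theorem letters_ext {v w : List (Fin 3)} (hl : v.length = w.length)
    (h : ∀ i < v.length, letters v i = letters w i) : v = w := by
  refine List.ext_getElem hl fun i hv hw => Fin.ext ?_
  have := h i hv
  rwa [letters, letters, List.getD_eq_getElem _ _ hv, List.getD_eq_getElem _ _ hw] at this

theorem squareFree_iff (w : List (Fin 3)) : SquareFree w ↔ NoSq (letters w) w.length := by
  constructor
  · intro h s q hq hs
    by_contra! hc
    obtain ⟨a, x, y, b, rfl, rfl, rfl, hy⟩ : ∃ a x y b : List (Fin 3), w = a ++ (x ++ (y ++ b)) ∧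
        a.length = s ∧ x.length = q ∧ y.length = x.length := by
      refine ⟨w.take s, (w.drop s).take q, ((w.drop s).drop q).take q, ((w.drop s).drop q).drop q,
        by simp, ?_, ?_, ?_⟩ <;> simp <;> omega
    obtain rfl : x = y := letters_ext hy.symm fun i hi => by
      have := hc i hi
      rwa [Nat.add_assoc, letters_append_right, letters_append_right, letters_append_left hi,
        Nat.add_comm i, letters_append_right, letters_append_left (hy ▸ hi)] at this
    exact h x (List.length_pos_iff.1 hq) ⟨a, b, by simp⟩
  · rintro h x hx ⟨a, b, rfl⟩
    obtain ⟨t, ht, hne⟩ := h a.length x.length (List.length_pos_iff.2 hx) (by simp; omega)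
    apply hne
    rw [List.append_assoc, List.append_assoc, Nat.add_assoc, letters_append_right,
      letters_append_right, letters_append_left ht, Nat.add_comm t, letters_append_right,
      letters_append_left ht]

theorem letters_insert (v w : List (Fin 3)) (a : Fin 3) (t : ℕ) :
    letters (v ++ [a] ++ w) t = ins (letters (v ++ w)) v.length a t := by
  rw [List.append_assoc]
  rcases lt_trichotomy t v.length with h | rfl | h
  · rw [ins_of_lt h, letters_append_left h, letters_append_left h]
  · rw [ins_self, ← Nat.add_zero v.length, letters_append_right]
    rfl
  · obtain ⟨t, rfl⟩ := Nat.exists_eq_add_of_lt h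
    rw [ins_succ (by omega), Nat.add_assoc, letters_append_right, letters_append_right]
    rfl

theorem extremalSquareFree_iff (w : List (Fin 3)) :
    ExtremalSquareFree w ↔ Extremal (letters w) w.length := by
  constructor
  · rintro ⟨h, hext⟩
    refine ⟨letters_lt_three w, (squareFree_iff w).1 h, fun i hi a ha hs => ?_⟩
    refine hext _ ⟨w.take i, w.drop i, ⟨a, ha⟩, by simp, rfl⟩ ((squareFree_iff _).2 ?_)
    convert hs using 1
    · funext t
      rw [letters_insert, List.take_append_drop, List.length_take, Nat.min_eq_left hi]
    · simp
      omega
  · intro E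
    refine ⟨(squareFree_iff w).2 E.noSq, ?_⟩
    rintro _ ⟨v, w, a, rfl, rfl⟩ hs
    refine E.ext v.length (by simp) a a.isLt ?_
    convert (squareFree_iff _).1 hs using 1
    · funext t
      exact (letters_insert v w a t).symm
    · simp
      omega

theorem Extremal.congr {f g : ℕ → ℕ} {n : ℕ} (E : Extremal f n) (hg : ∀ i, g i < 3)
    (h : ∀ i < n, f i = g i) : Extremal g n where
  lt_three := hg
  noSq := E.noSq.congr h
  ext i hi a ha hs := E.ext i hi a ha (hs.congr fun t ht => by
    simp only [ins]
    split_ifs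
    exacts [(h t (by omega)).symm, rfl, (h (t - 1) (by omega)).symm])

theorem exists_extremalSquareFree_iff (n : ℕ) :
    (∃ w : List (Fin 3), w.length = n ∧ ExtremalSquareFree w) ↔ ∃ f, Extremal f n := by
  constructor
  · rintro ⟨w, rfl, h⟩
    exact ⟨_, (extremalSquareFree_iff w).1 h⟩
  · rintro ⟨f, E⟩
    have hl : (List.ofFn fun i : Fin n => (⟨f i, E.lt_three i⟩ : Fin 3)).length = n :=
      List.length_ofFn
    refine ⟨_, hl, (extremalSquareFree_iff _).2 ?_⟩
    rw [hl]
    refine E.congr (letters_lt_three _) fun i hi => ?_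
    rw [letters, List.getD_eq_getElem _ _ (hl.symm ▸ hi), List.getElem_ofFn]

theorem exists_extremal_iff (n : ℕ) : (∃ f, Extremal f n) ↔
    n ∈ [25, 41, 48, 50, 63, 71, 72, 77, 79, 81, 83, 84, 85] ∨ 87 ≤ n := by
  constructor
  · rintro ⟨f, E⟩
    rcases Nat.lt_or_ge n 87 with h | h
    · exact Or.inl (mem_of_okLength n h (E.okLength (by omega)))
    · exact Or.inr h
  · rintro (h | h)
    · obtain ⟨w, hw, rfl⟩ := exists_words n h
      exact ⟨_, words_extremal hw⟩
    · exact exists_extremal h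

end TernaryWord

/-- Theorem 1: there is an extremal square-free ternary word of length `n` iff
`n ∈ 𝒜 = {25,41,48,50,63,71,72,77,79,81,83,84,85} ∪ {m : m ≥ 87}`. -/
theorem extremal_squarefree_lengths (n : ℕ) :
    (∃ w : List (Fin 3), w.length = n ∧ ExtremalSquareFree w) ↔
      n ∈ ({25, 41, 48, 50, 63, 71, 72, 77, 79, 81, 83, 84, 85} : Set ℕ) ∪ {m | 87 ≤ m} := by
  rw [TernaryWord.exists_extremalSquareFree_iff, TernaryWord.exists_extremal_iff]
  simp
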